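/- Let M be a simple binary matroid of rank r ≥ 5 with no AG(3,2)-minor. Then the number of elements of M is at most (r+1 choose 2). -/

import Mathlib

open Matroid Set

variable {α : Type*}

/-- Deletion of a set of elements from a matroid. -/
def Matroid.del (M : Matroid α) (D : Set α) : Matroid α := M ↾ (M.E \ D)

/-- Contraction of a set of elements in a matroid, defined by duality. -/
def Matroid.con (M : Matroid α) (C : Set α) : Matroid α := ((M✶).del C)✶

/-- `N` is a minor of `M` if it is obtained from `M` by a contraction followed by a deletion. -/
def Matroid.IsMinorOf (N M : Matroid α) : Prop := ∃ C D : Set α, N = (M.con C).del D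

/-- `C` is a circuit of `M`: a dependent set all of whose proper subsets are independent. -/
def Matroid.IsCircuitSet (M : Matroid α) (C : Set α) : Prop :=
  M.Dep C ∧ ∀ D ⊂ C, M.Indep D

/-- A matroid is simple if it has no circuits of size one or two, equivalently every
one- or two-element subset of the ground set is independent. -/
def Matroid.IsSimpleM (M : Matroid α) : Prop := ∀ e ∈ M.E, ∀ f ∈ M.E, M.Indep {e, f}

/-- The rank of a set `X` in a matroid `M`: the supremum of the sizes of independent
subsets of `X`. -/
noncomputable def Matroid.rks (M : Matroid α) (X : Set α) : ℕ :=
  sSup {n : ℕ | ∃ I ⊆ X, M.Indep I ∧ I.ncard = n}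

/-- The rank of a matroid. -/
noncomputable def Matroid.rkM (M : Matroid α) : ℕ := M.rks M.E

/-- `M` is represented over the field `F` by the vector assignment `φ`:
a subset of the ground set is independent iff `φ` is linearly independent on it. -/
def Matroid.IsRepBy (M : Matroid α) (F : Type*) [Field F] {W : Type*} [AddCommGroup W]
    [Module F W] (φ : α → W) : Prop :=
  ∀ I ⊆ M.E, (M.Indep I ↔ LinearIndependent F (I.restrict φ))

/-- `M` is representable over the field `F`. -/
def Matroid.IsRepOver (M : Matroid α) (F : Type) [Field F] : Prop :=
  ∃ (n : ℕ) (φ : α → (Fin n → F)), M.IsRepBy F φ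

/-- A binary matroid is one representable over the two-element field `GF(2)`. -/
def Matroid.IsBinaryM (M : Matroid α) : Prop := M.IsRepOver (ZMod 2)

/-- A regular matroid is one representable over every field. -/
def Matroid.IsRegularM (M : Matroid α) : Prop := ∀ (F : Type) [Field F], M.IsRepOver F

/-- `M` is isomorphic to the binary vector matroid on the set of vectors `V`:
there is a representation of `M` over `GF(2)` mapping the ground set bijectively to `V`. -/
def Matroid.IsBinaryIsoTo (M : Matroid α) {W : Type*} [AddCommGroup W] [Module (ZMod 2) W]
    (V : Set W) : Prop :=
  ∃ φ : α → W, M.IsRepBy (ZMod 2) φ ∧ Set.BijOn φ M.E V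

/-- The eight points of the binary affine cube `AG(3,2)`: the vectors `(1, x)` in `GF(2)⁴`. -/
def agVecs : Set (Fin 4 → ZMod 2) := {x | x 0 = 1}

/-- `M` has a minor isomorphic to `AG(3,2)`. -/
def Matroid.HasAGMinor (M : Matroid α) : Prop :=
  ∃ N : Matroid α, N.IsMinorOf M ∧ N.IsBinaryIsoTo agVecs

/-- The seven points of the Fano plane `F₇`: the nonzero vectors of `GF(2)³`. -/
def fanoVecs : Set (Fin 3 → ZMod 2) := {x | x ≠ 0}

/-- The vectors `eᵢ + eⱼ` (`i ≠ j`) representing the graphic matroid `M(K_n)`. -/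
def kVecs (n : ℕ) : Set (Fin n → ZMod 2) :=
  {x | ∃ i j : Fin n, i ≠ j ∧ x = Pi.single i 1 + Pi.single j 1}

/-- `ℓ` is a line (3-element circuit) of `M` through `x`. -/
def Matroid.IsLineThru (M : Matroid α) (x : α) (ℓ : Set α) : Prop :=
  M.IsCircuitSet ℓ ∧ ℓ.ncard = 3 ∧ x ∈ ℓ

/-- A matroid is connected if it is nonempty and every two distinct elements of the
ground set lie in a common circuit. -/
def Matroid.IsConnectedM (M : Matroid α) : Prop :=
  M.E.Nonempty ∧ ∀ e ∈ M.E, ∀ f ∈ M.E, e ≠ f →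
    ∃ C, M.IsCircuitSet C ∧ e ∈ C ∧ f ∈ C

/-- A matroid is 3-connected if it is connected and has no 2-separation, i.e. no partition
`(A, B)` of the ground set with `|A| ≥ 2`, `|B| ≥ 2` and `r(A) + r(B) - r(M) ≤ 1`. -/
def Matroid.IsThreeConnected (M : Matroid α) : Prop :=
  M.IsConnectedM ∧ ¬ ∃ A B : Set α, A ∪ B = M.E ∧ Disjoint A B ∧
    2 ≤ A.ncard ∧ 2 ≤ B.ncard ∧ M.rks A + M.rks B ≤ M.rkM + 1


set_option linter.unusedSectionVars false

namespace AGP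

open Submodule Module

variable {V : Type*} [AddCommGroup V] [Module (ZMod 2) V] [Fintype V] [DecidableEq V]

/-- Vector version of having an `AG(3,2)`-minor. -/
def AGv {V : Type*} [AddCommGroup V] [Module (ZMod 2) V] (S : Finset V) : Prop :=
  ∃ C : Set V, C ⊆ ↑S ∧ ∃ w x y z : V,
    (∀ a b c d : ZMod 2, a • w + b • x + c • y + d • z ∈ span (ZMod 2) C →
      a = 0 ∧ b = 0 ∧ c = 0 ∧ d = 0) ∧
    (∀ b c d : ZMod 2, ∃ s ∈ S, s + (w + b • x + c • y + d • z) ∈ span (ZMod 2) C)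

theorem AGv.mono {S T : Finset V} (h : AGv S) (hST : S ⊆ T) : AGv T := by
  obtain ⟨C, hC, w, x, y, z, h1, h2⟩ := h
  refine ⟨C, hC.trans (by exact_mod_cast hST), w, x, y, z, h1, fun b c d => ?_⟩
  obtain ⟨s, hs, h⟩ := h2 b c d
  exact ⟨s, hST hs, h⟩

theorem z2 (a : ZMod 2) : a = 0 ∨ a = 1 := by
  revert a; decide

theorem eq_of_add_zero {V : Type*} [AddCommGroup V] [Module (ZMod 2) V] {x y : V}
    (h : x + y = 0) : x = y := by
  have := ZModModule.add_self y
  calc x = x + (y + y) := by rw [this, add_zero]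
    _ = (x + y) + y := by abel
    _ = y := by rw [h, zero_add]

theorem add_add_self {V : Type*} [AddCommGroup V] [Module (ZMod 2) V] (x y : V) :
    x + y + y = x := by
  rw [add_assoc, ZModModule.add_self, add_zero]


/-- The size function. -/
def fm (r : ℕ) : ℕ := if r = 3 then 7 else if r = 4 then 11 else (r + 1).choose 2

theorem fm_le (r : ℕ) : 2 * fm r ≤ r * (r + 1) + 2 := by
  unfold fm
  split_ifs with h1 h2
  · subst h1; norm_num
  · subst h2; norm_num
  · rw [Nat.choose_two_right, Nat.add_sub_cancel]
    have := Nat.mul_div_le ((r + 1) * r) 2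
    nlinarith

theorem fm_eq {r : ℕ} (hr : 5 ≤ r) : 2 * fm r = r * (r + 1) := by
  unfold fm
  rw [if_neg (by omega), if_neg (by omega), Nat.choose_two_right, Nat.add_sub_cancel,
    Nat.mul_div_cancel' (by rw [mul_comm]; exact (Nat.even_mul_succ_self r).two_dvd), mul_comm]

theorem fm_mono : Monotone fm := by
  refine monotone_nat_of_le_succ fun n => ?_
  by_cases h : n < 5
  · interval_cases n <;> decide
  · have := fm_eq (r := n) (by omega)
    have := fm_eq (r := n + 1) (by omega)
    nlinarith

theorem fm_add {a b r : ℕ} (ha : 3 ≤ a) (hb : 3 ≤ b) (h : a + b ≤ r + 1) :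
    fm a + fm b ≤ fm r := by
  have h1 := fm_le a
  have h2 := fm_le b
  have h3 := fm_eq (r := r) (by omega)
  obtain ⟨a, rfl⟩ := Nat.exists_eq_add_of_le ha
  obtain ⟨b, rfl⟩ := Nat.exists_eq_add_of_le hb
  obtain ⟨c, hc⟩ := Nat.exists_eq_add_of_le h
  have hr : r = a + b + 5 + c := by omega
  subst hr
  nlinarith [Nat.zero_le (a * b), Nat.zero_le (a * c), Nat.zero_le (b * c)]


theorem mem_span_subset_sum {C : Finset V} {x : V} (h : x ∈ span (ZMod 2) (C : Set V)) :
    ∃ D ⊆ C, x = ∑ d ∈ D, d := by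
  rw [mem_span_finset] at h
  obtain ⟨g, -, rfl⟩ := h
  refine ⟨C.filter (fun d => g d = 1), Finset.filter_subset _ _, ?_⟩
  rw [Finset.sum_filter]
  refine Finset.sum_congr rfl fun d _ => ?_
  rcases z2 (g d) with h | h <;> simp [h]

/-- dependent set of vectors contains a nonempty zero-sum subset -/
theorem exists_zero_sum {R : Finset V} {W : Submodule (ZMod 2) V} (hR : ∀ x ∈ R, x ∈ W)
    (hc : finrank (ZMod 2) W < R.card) : ∃ K ⊆ R, K.Nonempty ∧ ∑ d ∈ K, d = 0 := by
  have hdep : ¬ LinearIndepOn (ZMod 2) id (R : Set V) := by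
    intro hli
    have h1 := finrank_span_finset_eq_card hli
    have h2 : finrank (ZMod 2) (span (ZMod 2) (R : Set V)) ≤ finrank (ZMod 2) W :=
      Submodule.finrank_mono (span_le.2 hR)
    omega
  rw [linearIndepOn_finset_iff] at hdep
  push Not at hdep
  obtain ⟨g, hg, i, hi, hgi⟩ := hdep
  refine ⟨R.filter (fun d => g d = 1), Finset.filter_subset _ _, ⟨i, ?_⟩, ?_⟩
  · rcases z2 (g i) with h | h
    · exact absurd h hgi
    · simp [hi, h]
  · rw [← hg, Finset.sum_filter]
    refine Finset.sum_congr rfl fun d _ => ?_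
    rcases z2 (g d) with h | h <;> simp [h]

/-- Lines through `e`: chosen representatives. -/
def Re (S : Finset V) (e : V) (l : V →ₗ[ZMod 2] ZMod 2) : Finset V :=
  S.filter (fun a => a + e ∈ S ∧ l a = 0)

theorem mem_Re {S : Finset V} {e : V} {l : V →ₗ[ZMod 2] ZMod 2} {a : V} :
    a ∈ Re S e l ↔ a ∈ S ∧ a + e ∈ S ∧ l a = 0 := by
  simp [Re]

theorem spike {S : Finset V} (h0 : (0 : V) ∉ S) (hAG : ¬ AGv S) {e : V} (he : e ∈ S)
    {l : V →ₗ[ZMod 2] ZMod 2} (hl : l e = 1) {R : Finset V} (hR : R ⊆ Re S e l)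
    (hc : finrank (ZMod 2) (span (ZMod 2) (S : Set V)) ≤ R.card) :
    ∃ a ∈ R, ∃ b ∈ R, a + b ∈ R ∧ a ≠ b := by
  have hW : finrank (ZMod 2) ↥(span (ZMod 2) (S : Set V) ⊓ LinearMap.ker l) <
      finrank (ZMod 2) (span (ZMod 2) (S : Set V)) := by
    apply Submodule.finrank_lt_finrank_of_lt
    refine lt_of_le_of_ne inf_le_left fun h => ?_
    have : e ∈ span (ZMod 2) (S : Set V) ⊓ LinearMap.ker l := by
      rw [h]; exact subset_span (by exact_mod_cast he)
    have := LinearMap.mem_ker.1 this.2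
    rw [hl] at this
    exact one_ne_zero this
  have hex := exists_zero_sum (R := R) (W := span (ZMod 2) (S : Set V) ⊓ LinearMap.ker l)
    (fun x hx => by
      have := mem_Re.1 (hR hx)
      exact ⟨subset_span (by exact_mod_cast this.1), this.2.2⟩) (by omega)
  -- minimal zero-sum subset
  obtain ⟨K0, hK0R, hK0n, hK0s⟩ := hex
  obtain ⟨K, hK, hmin⟩ := Finset.exists_min_image
    (R.powerset.filter (fun K => K.Nonempty ∧ ∑ d ∈ K, d = 0)) Finset.card
    ⟨K0, by simp [hK0R, hK0n, hK0s]⟩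
  simp only [Finset.mem_filter, Finset.mem_powerset] at hK hmin
  obtain ⟨hKR, hKn, hKs⟩ := hK
  have hRS : ∀ x ∈ R, x ∈ S ∧ x + e ∈ S ∧ l x = 0 := fun x hx => mem_Re.1 (hR hx)
  by_cases h4 : 4 ≤ K.card
  · exfalso
    apply hAG
    obtain ⟨L, hLK, hL⟩ := Finset.exists_subset_card_eq h4
    obtain ⟨p, q, t, u, hpq, hpt, hpu, hqt, hqu, htu, rfl⟩ := Finset.card_eq_four.1 hL
    have hpK : p ∈ K := hLK (by simp)
    have hqK : q ∈ K := hLK (by simp)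
    have htK : t ∈ K := hLK (by simp)
    have huK : u ∈ K := hLK (by simp)
    set C := K \ {p, q, t, u} with hC
    have hCK : C ⊆ K := Finset.sdiff_subset
    have hsum : p + q + t + u + ∑ d ∈ C, d = 0 := by
      rw [← hKs, ← Finset.sum_sdiff hLK, ← hC, add_comm]
      congr 1
      rw [Finset.sum_insert, Finset.sum_insert, Finset.sum_insert, Finset.sum_singleton]
      · abel
      all_goals simp [*]
    have hmem : ∀ x ∈ ({p, q, t, u} : Finset V), x ∉ C := by
      intro x hx; simp only [hC, Finset.mem_sdiff, not_and, not_not]; exact fun _ => hx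
    have hpC := hmem p (by simp)
    have hqC := hmem q (by simp)
    have htC := hmem t (by simp)
    have huC := hmem u (by simp)
    -- minimality: no nonempty zero-sum subset avoiding u
    have key : ∀ E : Finset V, E ⊆ K → u ∉ E → ∑ d ∈ E, d = 0 → E = ∅ := by
      intro E hE huE hs
      by_contra hne
      have h1 := hmin E ⟨hE.trans hKR, Finset.nonempty_iff_ne_empty.2 hne, hs⟩
      have h2 : E.card < K.card :=
        Finset.card_lt_card ⟨hE, fun h => huE (h huK)⟩
      omega
    refine ⟨(C : Set V), ?_, p, p + q, p + t, e, ?_, ?_⟩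
    · intro x hx
      exact_mod_cast (hRS x (hKR (hCK (by exact_mod_cast hx)))).1
    · intro a b c d h
      obtain ⟨D, hDC, hD⟩ := mem_span_subset_sum h
      have hlD : l (∑ x ∈ D, x) = 0 := by
        rw [map_sum]
        exact Finset.sum_eq_zero fun x hx => (hRS x (hKR (hCK (hDC hx)))).2.2
      have hd : d = 0 := by
        rw [← hD] at hlD
        simpa [map_add, (hRS p (hKR hpK)).2.2, (hRS q (hKR hqK)).2.2,
          (hRS t (hKR htK)).2.2, hl] using hlD
      subst hd
      have hDK := hDC.trans hCK
      have hpD : p ∉ D := fun h => hpC (hDC h)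
      have hqD : q ∉ D := fun h => hqC (hDC h)
      have htD : t ∉ D := fun h => htC (hDC h)
      have huD : u ∉ D := fun h => huC (hDC h)
      have h2p := ZModModule.add_self p
      have h2q := ZModModule.add_self q
      have h2t := ZModModule.add_self t
      rcases z2 a with rfl | rfl <;> rcases z2 b with rfl | rfl <;> rcases z2 c with rfl | rfl
      · simp
      · exfalso
        have := key (insert p (insert t D)) (by grind) (by grind) (by
          rw [Finset.sum_insert (by grind), Finset.sum_insert (by grind), ← hD]
          simp; grind)
        simp at this
      · exfalso
        have := key (insert p (insert q D)) (by grind) (by grind) (by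
          rw [Finset.sum_insert (by grind), Finset.sum_insert (by grind), ← hD]
          simp; grind)
        simp at this
      · exfalso
        have := key (insert q (insert t D)) (by grind) (by grind) (by
          rw [Finset.sum_insert (by grind), Finset.sum_insert (by grind), ← hD]
          simp; grind)
        simp at this
      · exfalso
        have := key (insert p D) (by grind) (by grind) (by
          rw [Finset.sum_insert (by grind), ← hD]
          simp; grind)
        simp at this
      · exfalso
        have := key (insert t D) (by grind) (by grind) (by
          rw [Finset.sum_insert (by grind), ← hD]
          simp; grind)
        simp at this
      · exfalso
        have := key (insert q D) (by grind) (by grind) (by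
          rw [Finset.sum_insert (by grind), ← hD]
          simp; grind)
        simp at this
      · exfalso
        have := key (insert p (insert q (insert t D))) (by grind) (by grind) (by
          rw [Finset.sum_insert (by grind), Finset.sum_insert (by grind),
            Finset.sum_insert (by grind), ← hD]
          simp; grind)
        simp at this
    · have hu : u + (p + q + t) ∈ span (ZMod 2) (C : Set V) := by
        have : u + (p + q + t) = ∑ d ∈ C, d := by
          apply eq_of_add_zero
          rw [← hsum]; abel
        rw [this]
        exact sum_mem fun x hx => subset_span (by exact_mod_cast hx)
      -- every vector of `K`, possibly shifted by `e`, is in `S`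
      have hsh : ∀ x ∈ K, ∀ d : ZMod 2, x + d • e ∈ S := by
        intro x hx d
        rcases z2 d with rfl | rfl
        · simpa using (hRS x (hKR hx)).1
        · simpa using (hRS x (hKR hx)).2.1
      have h2p := ZModModule.add_self p
      have h2q := ZModModule.add_self q
      have h2t := ZModModule.add_self t
      intro b c d
      have h2e := ZModModule.add_self (d • e)
      rcases z2 b with rfl | rfl <;> rcases z2 c with rfl | rfl
      · exact ⟨_, hsh p hpK d, by
          convert (span (ZMod 2) (C : Set V)).zero_mem using 1; simp; grind⟩
      · exact ⟨_, hsh t htK d, by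
          convert (span (ZMod 2) (C : Set V)).zero_mem using 1; simp; grind⟩
      · exact ⟨_, hsh q hqK d, by
          convert (span (ZMod 2) (C : Set V)).zero_mem using 1; simp; grind⟩
      · exact ⟨_, hsh u huK d, by
          convert hu using 1; simp; grind⟩
  · have hK0 : K.card ≠ 0 := by simpa using hKn.ne_empty
    have : K.card = 1 ∨ K.card = 2 ∨ K.card = 3 := by omega
    rcases this with h | h | h
    · obtain ⟨a, rfl⟩ := Finset.card_eq_one.1 h
      simp only [Finset.sum_singleton] at hKs
      subst hKs
      exact absurd (hRS 0 (hKR (by simp))).1 h0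
    · obtain ⟨a, b, hab, rfl⟩ := Finset.card_eq_two.1 h
      rw [Finset.sum_pair hab] at hKs
      exact absurd (eq_of_add_zero hKs) hab
    · obtain ⟨a, b, c, hab, hac, hbc, rfl⟩ := Finset.card_eq_three.1 h
      rw [Finset.sum_insert (by simp [hab, hac]), Finset.sum_pair hbc] at hKs
      have : a + b = c := eq_of_add_zero (by rw [← hKs]; abel)
      exact ⟨a, hKR (by simp), b, hKR (by simp), this ▸ hKR (by simp), hab⟩


theorem finrank_sup_singleton_le (U : Submodule (ZMod 2) V) (x : V) :
    finrank (ZMod 2) ↥(U ⊔ span (ZMod 2) {x}) ≤ finrank (ZMod 2) U + 1 := by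
  have h := Submodule.finrank_add_le_finrank_add_finrank U (span (ZMod 2) {x})
  have h2 : finrank (ZMod 2) (span (ZMod 2) {x}) ≤ 1 := by
    have := finrank_span_le_card (R := ZMod 2) ({x} : Set V)
    simpa using this
  omega

theorem finrank_sup_singleton {U : Submodule (ZMod 2) V} {x : V} (hx : x ∉ U) :
    finrank (ZMod 2) ↥(U ⊔ span (ZMod 2) {x}) = finrank (ZMod 2) U + 1 := by
  refine le_antisymm (finrank_sup_singleton_le U x) ?_
  apply Submodule.finrank_lt_finrank_of_lt
  refine lt_of_le_of_ne le_sup_left fun h => hx ?_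
  rw [h]
  exact mem_sup_right (mem_span_singleton_self x)

theorem mem_sup_singleton {U : Submodule (ZMod 2) V} {x v : V} :
    v ∈ U ⊔ span (ZMod 2) {x} ↔ v ∈ U ∨ v + x ∈ U := by
  constructor
  · intro h
    obtain ⟨u, hu, y, hy, rfl⟩ := Submodule.mem_sup.1 h
    obtain ⟨c, rfl⟩ := mem_span_singleton.1 hy
    rcases z2 c with rfl | rfl
    · left; simpa using hu
    · right; simpa [add_add_self] using hu
  · rintro (h | h)
    · exact mem_sup_left h
    · rw [← add_add_self v x]
      exact add_mem (mem_sup_left h) (mem_sup_right (mem_span_singleton_self x))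

theorem exists_notMem_of_finrank {U W : Submodule (ZMod 2) V}
    (h : finrank (ZMod 2) U < finrank (ZMod 2) W) : ∃ x ∈ W, x ∉ U := by
  by_contra hc
  push Not at hc
  have := Submodule.finrank_mono (R := ZMod 2) (show W ≤ U from hc)
  omega

theorem exists_functional {U : Submodule (ZMod 2) V} {x : V} (hx : x ∉ U) :
    ∃ l : V →ₗ[ZMod 2] ZMod 2, l x = 1 ∧ ∀ u ∈ U, l u = 0 := by
  obtain ⟨f, hf, hU⟩ := Submodule.exists_dual_map_eq_bot_of_notMem hx inferInstance
  refine ⟨f, ?_, fun u hu => ?_⟩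
  · rcases z2 (f x) with h | h
    · exact absurd h hf
    · exact h
  · have : f u ∈ U.map f := ⟨u, hu, rfl⟩
    rw [hU] at this
    simpa using this

/-- General way to produce an `AG(3,2)`-minor. -/
theorem AGv_of_coset {S : Finset V} {C : Set V} (hC : C ⊆ ↑S) {H : Submodule (ZMod 2) V}
    (hUH : span (ZMod 2) C ≤ H)
    (hH : finrank (ZMod 2) (span (ZMod 2) C) + 3 ≤ finrank (ZMod 2) H) {w : V} (hw : w ∉ H)
    (hS : ∀ v ∈ H, ∃ s ∈ S, s + (w + v) ∈ span (ZMod 2) C) : AGv S := by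
  set U := span (ZMod 2) C with hU
  obtain ⟨x, hxH, hx⟩ := exists_notMem_of_finrank (U := U) (W := H) (by omega)
  have h1 := finrank_sup_singleton_le U x
  obtain ⟨y, hyH, hy⟩ := exists_notMem_of_finrank (U := U ⊔ span (ZMod 2) {x}) (W := H) (by omega)
  have h2 := finrank_sup_singleton_le (U ⊔ span (ZMod 2) {x}) y
  obtain ⟨z, hzH, hz⟩ := exists_notMem_of_finrank
    (U := U ⊔ span (ZMod 2) {x} ⊔ span (ZMod 2) {y}) (W := H) (by omega)
  refine ⟨C, hC, w, x, y, z, ?_, ?_⟩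
  · intro a b c d h
    rw [← hU] at h
    have ha : a = 0 := by
      rcases z2 a with ha | ha
      · exact ha
      · exfalso; apply hw
        have h3 : b • x + c • y + d • z ∈ H :=
          add_mem (add_mem (smul_mem _ _ hxH) (smul_mem _ _ hyH)) (smul_mem _ _ hzH)
        have := sub_mem (hUH h) h3
        subst ha
        convert this using 1
        rw [one_smul]; abel
    subst ha
    have hd : d = 0 := by
      rcases z2 d with hd | hd
      · exact hd
      · exfalso; apply hz
        have h3 : b • x + c • y ∈ U ⊔ span (ZMod 2) {x} ⊔ span (ZMod 2) {y} :=
          add_mem (smul_mem _ _ (mem_sup_left (mem_sup_right (mem_span_singleton_self x))))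
            (smul_mem _ _ (mem_sup_right (mem_span_singleton_self y)))
        have := sub_mem (mem_sup_left (mem_sup_left h)) h3
        subst hd
        convert this using 1
        rw [one_smul, zero_smul]; abel
    subst hd
    have hc : c = 0 := by
      rcases z2 c with hd | hd
      · exact hd
      · exfalso; apply hy
        have h3 : b • x ∈ U ⊔ span (ZMod 2) {x} :=
          smul_mem _ _ (mem_sup_right (mem_span_singleton_self x))
        have := sub_mem (mem_sup_left h) h3
        subst hd
        convert this using 1
        rw [one_smul, zero_smul, zero_smul]; abel
    subst hc
    refine ⟨rfl, ?_, rfl, rfl⟩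
    rcases z2 b with hb | hb
    · exact hb
    · exfalso; apply hx
      subst hb
      simpa using h
  · intro b c d
    obtain ⟨s, hs, h⟩ := hS (b • x + c • y + d • z)
      (add_mem (add_mem (smul_mem _ _ hxH) (smul_mem _ _ hyH)) (smul_mem _ _ hzH))
    refine ⟨s, hs, ?_⟩
    convert h using 1
    abel

/-- `F` is a Fano plane contained in `S`. -/
def IsFano (S : Finset V) (F : Submodule (ZMod 2) V) : Prop :=
  finrank (ZMod 2) F = 3 ∧ ∀ x ∈ F, x ≠ 0 → x ∈ S

theorem two_fano {S D : Finset V} (hD : D ⊆ S) {F G : Submodule (ZMod 2) V}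
    (hF : IsFano S F) (hG : IsFano S G) {k : ℕ}
    (h0 : finrank (ZMod 2) (span (ZMod 2) (D : Set V)) = k)
    (h1 : finrank (ZMod 2) ↥(F ⊔ span (ZMod 2) (D : Set V)) = k + 3)
    (h2 : finrank (ZMod 2) ↥(G ⊔ span (ZMod 2) (D : Set V)) = k + 3)
    (h3 : finrank (ZMod 2) ↥(F ⊔ G ⊔ span (ZMod 2) (D : Set V)) = k + 4) : AGv S := by
  have hUdef : ∃ U, U = span (ZMod 2) (D : Set V) := ⟨_, rfl⟩
  obtain ⟨U, hU⟩ := hUdef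
  rw [← hU] at h0 h1 h2 h3
  have hsup : (F ⊔ U) ⊔ (G ⊔ U) = F ⊔ G ⊔ U := by
    rw [sup_sup_sup_comm, sup_idem]
  have hinf := Submodule.finrank_sup_add_finrank_inf_eq (F ⊔ U) (G ⊔ U)
  rw [hsup] at hinf
  obtain ⟨a, haP, haP'⟩ : ∃ a ∈ F ⊔ U, a ∉ G ⊔ U := by
    by_contra hc; push Not at hc
    have : F ⊔ U ⊔ (G ⊔ U) = G ⊔ U := sup_eq_right.2 hc
    rw [← hsup, this] at h3; omega
  obtain ⟨b, hbP', hbP⟩ : ∃ b ∈ G ⊔ U, b ∉ F ⊔ U := by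
    by_contra hc; push Not at hc
    have : F ⊔ U ⊔ (G ⊔ U) = F ⊔ U := sup_eq_left.2 hc
    rw [← hsup, this] at h3; omega
  have hab : a + b ∉ (F ⊔ U) ⊓ (G ⊔ U) := by
    intro h
    apply hbP
    have := sub_mem h.1 haP
    simpa using this
  have hfr := finrank_sup_singleton hab
  have hUP : U ≤ (F ⊔ U) ⊓ (G ⊔ U) := le_inf le_sup_right le_sup_right
  have lift : ∀ E : Submodule (ZMod 2) V, IsFano S E → ∀ v ∈ E ⊔ U, v ∉ U →
      ∃ s ∈ S, s + v ∈ U := by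
    intro E hE v hv hvU
    obtain ⟨f, hf, u, hu, rfl⟩ := Submodule.mem_sup.1 hv
    refine ⟨f, hE.2 f hf ?_, ?_⟩
    · rintro rfl; exact hvU (by simpa using hu)
    · rw [← add_assoc, ZModModule.add_self, zero_add]; exact hu
  subst hU
  refine AGv_of_coset (C := (D : Set V)) (by exact_mod_cast hD)
    (H := ((F ⊔ span (ZMod 2) (D : Set V)) ⊓ (G ⊔ span (ZMod 2) (D : Set V))) ⊔
      span (ZMod 2) {a + b}) (hUP.trans le_sup_left) (by omega) (w := a) ?_ ?_
  · rw [mem_sup_singleton]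
    rintro (h | h)
    · exact haP' h.2
    · rw [← add_assoc, ZModModule.add_self, zero_add] at h
      exact hbP h.1
  · intro v hv
    rw [mem_sup_singleton] at hv
    rcases hv with h | h
    · refine lift F hF (a + v) (add_mem haP h.1) fun hc => haP' ?_
      have := sub_mem (mem_sup_right hc) h.2
      simpa using this
    · have hbv : a + v = (v + (a + b)) + b := by
        rw [← add_assoc, add_add_self, add_comm]
      rw [hbv]
      refine lift G hG _ (add_mem h.2 hbP') fun hc => hbP ?_
      have := sub_mem (mem_sup_right hc) h.1
      simpa using this

/-- The elements of a subspace as a finset. -/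
noncomputable def Wf (W : Submodule (ZMod 2) V) : Finset V := (Set.toFinite (W : Set V)).toFinset

theorem mem_Wf {W : Submodule (ZMod 2) V} {v : V} : v ∈ Wf W ↔ v ∈ W := by
  simp [Wf]

theorem card_submodule (W : Submodule (ZMod 2) V) :
    (Wf W).card = 2 ^ finrank (ZMod 2) W := by
  have h := Module.natCard_eq_pow_finrank (K := ZMod 2) (V := W)
  rw [Nat.card_zmod] at h
  rw [← h, Wf, ← Set.ncard_eq_toFinset_card]
  rfl

theorem card_le_pow {S : Finset V} (h0 : (0 : V) ∉ S) {W : Submodule (ZMod 2) V}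
    (hW : ∀ s ∈ S, s ∈ W) : S.card + 1 ≤ 2 ^ finrank (ZMod 2) W := by
  rw [← card_submodule, ← Finset.card_insert_of_notMem h0]
  apply Finset.card_le_card
  intro x hx
  rcases Finset.mem_insert.1 hx with rfl | hx
  · exact mem_Wf.2 (zero_mem _)
  · exact mem_Wf.2 (hW x hx)

theorem rank_four {S : Finset V} (h0 : (0 : V) ∉ S) (hAG : ¬ AGv S)
    (hr : finrank (ZMod 2) (span (ZMod 2) (S : Set V)) = 4) : S.card ≤ 11 := by
  by_contra hc
  apply hAG
  set W := span (ZMod 2) (S : Set V) with hW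
  have hSW : ∀ s ∈ S, s ∈ W := fun s hs => subset_span (by exact_mod_cast hs)
  set Z := Wf W \ insert 0 S with hZ
  have hZc : Z.card ≤ 3 := by
    have h1 : insert 0 S ⊆ Wf W := by
      intro x hx
      rcases Finset.mem_insert.1 hx with rfl | hx
      · exact mem_Wf.2 (zero_mem _)
      · exact mem_Wf.2 (hSW x hx)
    rw [hZ, Finset.card_sdiff_of_subset h1, card_submodule, hr, Finset.card_insert_of_notMem h0]
    omega
  have hsp : finrank (ZMod 2) (span (ZMod 2) (Z : Set V)) ≤ 3 := by
    have := finrank_span_finset_le_card (R := ZMod 2) Z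
    unfold Set.finrank at this
    omega
  obtain ⟨w, hwW, hw⟩ := exists_notMem_of_finrank (U := span (ZMod 2) (Z : Set V)) (W := W)
    (by omega)
  obtain ⟨l, hl1, hl0⟩ := exists_functional hw
  have hH : finrank (ZMod 2) W ≤ finrank (ZMod 2) ↥(W ⊓ LinearMap.ker l) + 1 := by
    refine le_trans (Submodule.finrank_mono ?_) (finrank_sup_singleton_le (W ⊓ LinearMap.ker l) w)
    intro v hv
    rw [mem_sup_singleton]
    rcases z2 (l v) with h | h
    · exact Or.inl ⟨hv, h⟩
    · refine Or.inr ⟨add_mem hv hwW, ?_⟩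
      simp only [SetLike.mem_coe, LinearMap.mem_ker, map_add, h, hl1]
      decide
  refine AGv_of_coset (C := ∅) (by simp) (H := W ⊓ LinearMap.ker l) (by simp)
    (by rw [span_empty, finrank_bot]; omega) (w := w) ?_ ?_
  · rintro ⟨-, h⟩
    simp [hl1] at h
  · rintro v ⟨hvW, hv⟩
    have hv' : l v = 0 := hv
    refine ⟨w + v, ?_, by rw [ZModModule.add_self]; exact zero_mem _⟩
    by_contra hn
    have hl : l (w + v) = 1 := by rw [map_add, hl1, hv', add_zero]
    have hz : w + v ∈ Z := by
      rw [hZ, Finset.mem_sdiff, Finset.mem_insert, not_or]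
      refine ⟨mem_Wf.2 (add_mem hwW hvW), ?_, hn⟩
      intro h; rw [h] at hl; simp at hl
    rw [hl0 _ (subset_span (by exact_mod_cast hz))] at hl
    exact zero_ne_one hl


theorem contract {S : Finset V} (h0 : (0 : V) ∉ S) (hAG : ¬ AGv S)
    (ih : ∀ T : Finset V, (0 : V) ∉ T → ¬ AGv T →
      finrank (ZMod 2) (span (ZMod 2) (T : Set V)) < finrank (ZMod 2) (span (ZMod 2) (S : Set V)) →
      T.card ≤ fm (finrank (ZMod 2) (span (ZMod 2) (T : Set V))))
    {e : V} (he : e ∈ S) {l : V →ₗ[ZMod 2] ZMod 2} (hl : l e = 1) :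
    S.card ≤ fm (finrank (ZMod 2) (span (ZMod 2) (S : Set V)) - 1) + (Re S e l).card + 1 := by
  set p : V → V := fun v => v + l v • e with hp
  set T := (S.erase e).image p with hT
  have hlp : ∀ v, l (p v) = 0 := by
    intro v
    simp only [hp, map_add, map_smul, hl, smul_eq_mul, mul_one]
    exact ZModModule.add_self (l v)
  have hT0 : (0 : V) ∉ T := by
    intro h
    obtain ⟨s, hs, hs0⟩ := Finset.mem_image.1 h
    obtain ⟨hse, hsS⟩ := Finset.mem_erase.1 hs
    rcases z2 (l s) with h1 | h1
    · simp only [hp, h1, zero_smul, add_zero] at hs0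
      exact h0 (hs0 ▸ hsS)
    · simp only [hp, h1, one_smul] at hs0
      exact hse (eq_of_add_zero hs0)
  have hTl : ∀ t ∈ T, l t = 0 := by
    intro t ht
    obtain ⟨s, -, rfl⟩ := Finset.mem_image.1 ht
    exact hlp s
  have hTspan : span (ZMod 2) (T : Set V) ≤ span (ZMod 2) (S : Set V) ⊓ LinearMap.ker l := by
    rw [span_le]
    intro t ht
    have ht' : t ∈ T := by exact_mod_cast ht
    refine ⟨?_, hTl t ht'⟩
    obtain ⟨s, hs, rfl⟩ := Finset.mem_image.1 ht'
    exact add_mem (subset_span (by exact_mod_cast (Finset.mem_of_mem_erase hs)))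
      (smul_mem _ _ (subset_span (by exact_mod_cast he)))
  have hlt : finrank (ZMod 2) (span (ZMod 2) (T : Set V)) <
      finrank (ZMod 2) (span (ZMod 2) (S : Set V)) := by
    apply Submodule.finrank_lt_finrank_of_lt
    refine lt_of_le_of_ne (hTspan.trans inf_le_left) fun h => ?_
    have : e ∈ span (ZMod 2) (T : Set V) := by
      rw [h]; exact subset_span (by exact_mod_cast he)
    have := LinearMap.mem_ker.1 (hTspan this).2
    rw [hl] at this
    exact one_ne_zero this
  have hTAG : ¬ AGv T := by
    rintro ⟨C, hC, w, x, y, z, h1, h2⟩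
    apply hAG
    have hCl : ∀ u ∈ span (ZMod 2) C, l u = 0 := fun u hu =>
      LinearMap.mem_ker.1 (hTspan (span_mono hC hu)).2
    have hcube : ∀ b c d : ZMod 2, l (w + b • x + c • y + d • z) = 0 := by
      intro b c d
      obtain ⟨s, hs, h⟩ := h2 b c d
      have := hCl _ h
      rwa [map_add, hTl s hs, zero_add] at this
    have hw : l w = 0 := by simpa using hcube 0 0 0
    have hx : l x = 0 := by simpa [hw] using hcube 1 0 0
    have hy : l y = 0 := by simpa [hw] using hcube 0 1 0
    have hz : l z = 0 := by simpa [hw] using hcube 0 0 1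
    have hspan : span (ZMod 2) {s | s ∈ S ∧ (p s ∈ C ∨ s = e)} =
        span (ZMod 2) C ⊔ span (ZMod 2) {e} := by
      apply le_antisymm
      · rw [span_le]
        rintro s ⟨hs, hs' | rfl⟩
        · have : s = p s + l s • e := by simp only [hp]; rw [add_add_self]
          rw [this]
          exact add_mem (mem_sup_left (subset_span hs'))
            (smul_mem _ _ (mem_sup_right (mem_span_singleton_self e)))
        · exact mem_sup_right (mem_span_singleton_self s)
      · have hee : e ∈ span (ZMod 2) {s | s ∈ S ∧ (p s ∈ C ∨ s = e)} :=
          subset_span ⟨he, Or.inr rfl⟩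
        refine sup_le ?_ ?_
        · rw [span_le]
          intro c hc
          have hcT : c ∈ T := by exact_mod_cast hC hc
          obtain ⟨s, hs, rfl⟩ := Finset.mem_image.1 hcT
          refine add_mem (subset_span ⟨Finset.mem_of_mem_erase hs, Or.inl hc⟩) (smul_mem _ _ hee)
        · rw [span_le]
          rintro _ rfl
          exact hee
    refine ⟨{s | s ∈ S ∧ (p s ∈ C ∨ s = e)}, fun s hs => by exact_mod_cast hs.1,
      w, x, y, z, ?_, ?_⟩
    · intro a b c d h
      rw [hspan, mem_sup_singleton] at h
      rcases h with h | h
      · exact h1 a b c d h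
      · have := hCl _ h
        simp [hw, hx, hy, hz, hl] at this
    · intro b c d
      obtain ⟨t, ht, h⟩ := h2 b c d
      obtain ⟨s, hs, rfl⟩ := Finset.mem_image.1 ht
      refine ⟨s, Finset.mem_of_mem_erase hs, ?_⟩
      rw [hspan]
      have : s + (w + b • x + c • y + d • z) =
          (p s + (w + b • x + c • y + d • z)) + l s • e := by
        have h3 : s = p s + l s • e := by simp only [hp]; rw [add_add_self]
        nth_rewrite 1 [h3]
        abel
      rw [this]
      exact add_mem (mem_sup_left h) (smul_mem _ _ (mem_sup_right (mem_span_singleton_self e)))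
  have hTc := (ih T hT0 hTAG hlt).trans (fm_mono (Nat.le_sub_one_of_lt hlt))
  have hcard : ((S.erase e) \ Re S e l).card ≤ T.card := by
    apply Finset.card_le_card_of_injOn p
    · intro s hs
      have hs' : s ∈ (S.erase e) \ Re S e l := by exact_mod_cast hs
      exact_mod_cast Finset.mem_image_of_mem p (Finset.mem_sdiff.1 hs').1
    · intro s hs t ht hst
      have hs' : s ∈ (S.erase e) \ Re S e l := by exact_mod_cast hs
      have ht' : t ∈ (S.erase e) \ Re S e l := by exact_mod_cast ht
      simp only [Finset.mem_sdiff, Finset.mem_erase, mem_Re] at hs' ht'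
      obtain ⟨⟨-, hsS⟩, hsR⟩ := hs'
      obtain ⟨⟨-, htS⟩, htR⟩ := ht'
      simp only [hp] at hst
      rcases z2 (l s) with h1 | h1 <;> rcases z2 (l t) with h2 | h2
      · simpa [h1, h2] using hst
      · simp only [h1, h2, zero_smul, add_zero, one_smul] at hst
        exact absurd ⟨hsS, by rw [hst, add_add_self]; exact htS, h1⟩ hsR
      · simp only [h1, h2, zero_smul, add_zero, one_smul] at hst
        exact absurd ⟨htS, by rw [← hst, add_add_self]; exact hsS, h2⟩ htR
      · simpa [h1, h2] using hst
  have h5 := Finset.le_card_sdiff (Re S e l) (S.erase e)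
  rw [Finset.card_erase_of_mem he] at h5
  omega

theorem fano_of_triangle {S : Finset V} {e : V} (he : e ∈ S) (h0 : (0 : V) ∉ S)
    {l : V →ₗ[ZMod 2] ZMod 2} (hl : l e = 1) {a b : V} (ha : a ∈ Re S e l) (hb : b ∈ Re S e l)
    (hab : a + b ∈ Re S e l) (hne : a ≠ b) :
    ∃ F, IsFano S F ∧ e ∈ F ∧ ∀ x ∈ F, x ≠ 0 → l x = 0 → x = a ∨ x = b ∨ x = a + b := by
  rw [mem_Re] at ha hb hab
  have ha0 : a ≠ 0 := fun h => h0 (h ▸ ha.1)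
  have hb0 : b ≠ 0 := fun h => h0 (h ▸ hb.1)
  refine ⟨⊥ ⊔ span (ZMod 2) {a} ⊔ span (ZMod 2) {b} ⊔ span (ZMod 2) {e}, ⟨?_, ?_⟩, ?_, ?_⟩
  · rw [finrank_sup_singleton, finrank_sup_singleton, finrank_sup_singleton, finrank_bot]
    · simpa using ha0
    · rw [mem_sup_singleton, mem_bot, mem_bot, not_or]
      exact ⟨hb0, fun h => hne (eq_of_add_zero h).symm⟩
    · intro h
      have h2 : (⊥ ⊔ span (ZMod 2) {a} ⊔ span (ZMod 2) {b}) ≤ LinearMap.ker l := by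
        refine sup_le (sup_le bot_le ?_) ?_
        · rw [span_le]; rintro _ rfl; exact ha.2.2
        · rw [span_le]; rintro _ rfl; exact hb.2.2
      have := LinearMap.mem_ker.1 (h2 h)
      rw [hl] at this
      exact one_ne_zero this
  · intro x hx hx0
    simp only [mem_sup_singleton, mem_bot] at hx
    rcases hx with ((h | h) | (h | h)) | ((h | h) | (h | h))
    · exact absurd h hx0
    · rw [eq_of_add_zero h]; exact ha.1
    · rw [eq_of_add_zero h]; exact hb.1
    · have : x = a + b := by
        apply eq_of_add_zero; rw [← h]; abel
      rw [this]; exact hab.1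
    · rw [eq_of_add_zero h]; exact he
    · have : x = a + e := by
        apply eq_of_add_zero; rw [← h]; abel
      rw [this]; exact ha.2.1
    · have : x = b + e := by
        apply eq_of_add_zero; rw [← h]; abel
      rw [this]; exact hb.2.1
    · have : x = a + b + e := by
        apply eq_of_add_zero; rw [← h]; abel
      rw [this]; exact hab.2.1
  · exact mem_sup_right (mem_span_singleton_self e)
  · intro x hx hx0 hlx
    simp only [mem_sup_singleton, mem_bot] at hx
    have hcon : ∀ y, l y = 0 → x = y + e → False := by
      intro y hy h
      rw [h, map_add, hy, hl] at hlx
      simp at hlx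
    rcases hx with ((h | h) | (h | h)) | ((h | h) | (h | h))
    · exact absurd h hx0
    · exact Or.inl (eq_of_add_zero h)
    · exact Or.inr (Or.inl (eq_of_add_zero h))
    · refine Or.inr (Or.inr ?_)
      apply eq_of_add_zero; rw [← h]; abel
    · exact (hcon 0 (map_zero l) (by rw [zero_add]; exact eq_of_add_zero h)).elim
    · exact (hcon a ha.2.2 (by apply eq_of_add_zero; rw [← h]; abel)).elim
    · exact (hcon b hb.2.2 (by apply eq_of_add_zero; rw [← h]; abel)).elim
    · exact (hcon (a + b) hab.2.2 (by apply eq_of_add_zero; rw [← h]; abel)).elim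

/-- relative rank -/
noncomputable def rr (F : Submodule (ZMod 2) V) (A : Finset V) : ℕ :=
  finrank (ZMod 2) ↥(F ⊔ span (ZMod 2) (A : Set V))

theorem rr_empty (F : Submodule (ZMod 2) V) : rr F ∅ = finrank (ZMod 2) F := by
  rw [rr, Finset.coe_empty, span_empty, sup_bot_eq]

theorem rr_mono (F : Submodule (ZMod 2) V) {A B : Finset V} (h : A ⊆ B) : rr F A ≤ rr F B :=
  Submodule.finrank_mono (sup_le_sup_left (span_mono (by exact_mod_cast h)) _)

theorem rr_submod (F : Submodule (ZMod 2) V) (A B : Finset V) :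
    rr F (A ∪ B) + rr F (A ∩ B) ≤ rr F A + rr F B := by
  unfold rr
  rw [← Submodule.finrank_sup_add_finrank_inf_eq (F ⊔ span (ZMod 2) (A : Set V))]
  apply add_le_add
  · apply Submodule.finrank_mono
    rw [Finset.coe_union, span_union, sup_sup_sup_comm, sup_idem]
  · apply Submodule.finrank_mono
    refine le_inf ?_ ?_ <;> refine sup_le_sup_left (span_mono ?_) _ <;> simp

theorem sup_insert (F : Submodule (ZMod 2) V) (e : V) (A : Finset V) :
    F ⊔ span (ZMod 2) ((insert e A : Finset V) : Set V) =
      F ⊔ span (ZMod 2) {e} ⊔ span (ZMod 2) (A : Set V) := by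
  rw [Finset.coe_insert, span_insert, sup_assoc]

theorem rr_insert (F : Submodule (ZMod 2) V) (e : V) (A : Finset V) :
    rr F (insert e A) = rr (F ⊔ span (ZMod 2) {e}) A := by
  unfold rr
  rw [sup_insert]

theorem rr_insert_le (F : Submodule (ZMod 2) V) (e : V) (A : Finset V) :
    rr F (insert e A) ≤ rr F A + 1 := by
  unfold rr
  rw [sup_insert, sup_right_comm]
  exact finrank_sup_singleton_le _ _

theorem rr_insert_mem {F : Submodule (ZMod 2) V} {e : V} (he : e ∈ F) (A : Finset V) :
    rr F (insert e A) = rr F A := by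
  rw [rr_insert]
  have : F ⊔ span (ZMod 2) {e} = F := by
    rw [sup_eq_left, span_le]; rintro _ rfl; exact he
  rw [this]

theorem rr_union_le (F : Submodule (ZMod 2) V) (A B : Finset V) :
    rr F (A ∪ B) ≤ rr F A + B.card := by
  induction B using Finset.induction_on with
  | empty => simp
  | insert e B he ih =>
    rw [Finset.union_insert, Finset.card_insert_of_notMem he]
    have := rr_insert_le F e (A ∪ B)
    omega

/-- Matroid intersection theorem for vectors. -/
theorem mat_inter (X : Finset V) : ∀ (F G : Submodule (ZMod 2) V) (k : ℕ),
    (∀ A ⊆ X, k + finrank (ZMod 2) F + finrank (ZMod 2) G ≤ rr F A + rr G (X \ A)) →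
    ∃ C ⊆ X, C.card = k ∧ rr F C = finrank (ZMod 2) F + k ∧ rr G C = finrank (ZMod 2) G + k := by
  induction X using Finset.induction_on with
  | empty =>
    intro F G k h
    have := h ∅ (by simp)
    simp only [Finset.sdiff_self, rr_empty] at this
    have hk : k = 0 := by omega
    subst hk
    exact ⟨∅, by simp, by simp, by simp [rr_empty], by simp [rr_empty]⟩
  | insert e X he ih =>
    intro F G k h
    by_cases h1 : ∀ A ⊆ X, k + finrank (ZMod 2) F + finrank (ZMod 2) G ≤ rr F A + rr G (X \ A)
    · obtain ⟨C, hC, h2⟩ := ih F G k h1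
      exact ⟨C, hC.trans (Finset.subset_insert _ _), h2⟩
    push Not at h1
    obtain ⟨A, hA, hA1⟩ := h1
    have heA : e ∉ A := fun h => he (hA h)
    have hs1 : insert e X \ insert e A = X \ A := by
      ext x; simp only [Finset.mem_sdiff, Finset.mem_insert]; grind
    have hs2 : insert e X \ A = insert e (X \ A) := by
      ext x; simp only [Finset.mem_sdiff, Finset.mem_insert]; grind
    have heF : e ∉ F := by
      intro heF
      have := h (insert e A) (Finset.insert_subset_insert _ hA)
      rw [hs1, rr_insert_mem heF] at this
      omega
    have heG : e ∉ G := by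
      intro heG
      have := h A (hA.trans (Finset.subset_insert _ _))
      rw [hs2, rr_insert_mem heG] at this
      omega
    have hk : 1 ≤ k := by
      have h2 := rr_mono F (Finset.empty_subset A)
      have h3 := rr_mono G (Finset.empty_subset (X \ A))
      rw [rr_empty] at h2 h3
      omega
    have hF' := finrank_sup_singleton heF
    have hG' := finrank_sup_singleton heG
    by_cases h2 : ∀ B ⊆ X, (k - 1) + finrank (ZMod 2) ↥(F ⊔ span (ZMod 2) {e}) +
        finrank (ZMod 2) ↥(G ⊔ span (ZMod 2) {e}) ≤
        rr (F ⊔ span (ZMod 2) {e}) B + rr (G ⊔ span (ZMod 2) {e}) (X \ B)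
    · obtain ⟨C, hC, hc, hCF, hCG⟩ := ih _ _ (k - 1) h2
      refine ⟨insert e C, Finset.insert_subset_insert _ hC, ?_, ?_, ?_⟩
      · rw [Finset.card_insert_of_notMem (fun h => he (hC h))]; omega
      · rw [rr_insert]; omega
      · rw [rr_insert]; omega
    · exfalso
      push Not at h2
      obtain ⟨B, hB, hB1⟩ := h2
      rw [← rr_insert, ← rr_insert] at hB1
      have h3 := rr_submod F A (insert e B)
      have h4 := rr_submod G (X \ A) (insert e (X \ B))
      have h5 := h (insert e (A ∪ B))
        (Finset.insert_subset_insert _ (Finset.union_subset hA hB))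
      have h6 := h (A ∩ B)
        ((Finset.inter_subset_left.trans hA).trans (Finset.subset_insert _ _))
      have e1 : A ∪ insert e B = insert e (A ∪ B) := by
        ext x; simp only [Finset.mem_union, Finset.mem_insert]; grind
      have e2 : A ∩ insert e B = A ∩ B := by
        ext x; simp only [Finset.mem_inter, Finset.mem_insert]; grind
      have e3 : (X \ A) ∪ insert e (X \ B) = insert e X \ (A ∩ B) := by
        ext x; simp only [Finset.mem_union, Finset.mem_insert, Finset.mem_sdiff, Finset.mem_inter]
        grind
      have e4 : (X \ A) ∩ insert e (X \ B) = insert e X \ insert e (A ∪ B) := by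
        ext x; simp only [Finset.mem_union, Finset.mem_insert, Finset.mem_sdiff, Finset.mem_inter]
        grind
      rw [e1, e2] at h3
      rw [e3, e4] at h4
      omega

theorem fano_unique {S : Finset V} (h0 : (0 : V) ∉ S) (hAG : ¬ AGv S)
    (ih : ∀ T : Finset V, (0 : V) ∉ T → ¬ AGv T →
      finrank (ZMod 2) (span (ZMod 2) (T : Set V)) < finrank (ZMod 2) (span (ZMod 2) (S : Set V)) →
      T.card ≤ fm (finrank (ZMod 2) (span (ZMod 2) (T : Set V))))
    {r : ℕ} (hr : finrank (ZMod 2) (span (ZMod 2) (S : Set V)) = r) (hr5 : 5 ≤ r)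
    (hS : fm r < S.card) {F G : Submodule (ZMod 2) V} (hF : IsFano S F) (hG : IsFano S G) :
    F = G := by
  classical
  by_contra hne
  apply hAG
  have hFS : ∀ E, IsFano S E → E ≤ span (ZMod 2) (S : Set V) := by
    intro E hE x hx
    by_cases h : x = 0
    · rw [h]; exact zero_mem _
    · exact subset_span (by exact_mod_cast hE.2 x hx h)
  have part : ∀ W : Submodule (ZMod 2) V, finrank (ZMod 2) W < r →
      (S.filter (fun s => s ∈ W)).card ≤ fm (finrank (ZMod 2) W) := by
    intro W hW
    have h1 : finrank (ZMod 2) (span (ZMod 2) ((S.filter (fun s => s ∈ W) : Finset V) : Set V)) ≤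
        finrank (ZMod 2) W := by
      apply Submodule.finrank_mono
      rw [span_le]
      intro x hx
      have : x ∈ S.filter (fun s => s ∈ W) := by exact_mod_cast hx
      exact (Finset.mem_filter.1 this).2
    refine (ih _ ?_ ?_ ?_).trans (fm_mono h1)
    · simp [h0]
    · exact fun h => hAG (h.mono (Finset.filter_subset _ _))
    · omega
  obtain ⟨C, hCS, hCc, hCF, hCG⟩ := mat_inter S F G (r - 4) (by
    intro A hA
    rw [hF.1, hG.1]
    by_contra hlt
    have a1 := rr_mono F (Finset.empty_subset A)
    have a2 := rr_mono G (Finset.empty_subset (S \ A))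
    rw [rr_empty, hF.1] at a1
    rw [rr_empty, hG.1] at a2
    have b1 : _ ≤ fm (rr F A) := part (F ⊔ span (ZMod 2) (A : Set V))
      (by change rr F A < r; omega)
    have b2 : _ ≤ fm (rr G (S \ A)) := part (G ⊔ span (ZMod 2) ((S \ A : Finset V) : Set V))
      (by change rr G (S \ A) < r; omega)
    have b3 := fm_add a1 a2 (r := r) (by omega)
    have hsub : S ⊆ S.filter (fun s => s ∈ F ⊔ span (ZMod 2) (A : Set V)) ∪
        S.filter (fun s => s ∈ G ⊔ span (ZMod 2) ((S \ A : Finset V) : Set V)) := by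
      intro s hs
      rw [Finset.mem_union, Finset.mem_filter, Finset.mem_filter]
      by_cases hsA : s ∈ A
      · exact Or.inl ⟨hs, mem_sup_right (subset_span (by exact_mod_cast hsA))⟩
      · refine Or.inr ⟨hs, mem_sup_right (subset_span ?_)⟩
        simp [hs, hsA]
    have := (Finset.card_le_card hsub).trans (Finset.card_union_le _ _)
    omega)
  have hFG : 4 ≤ finrank (ZMod 2) ↥(F ⊔ G) := by
    by_contra hlt
    have e1 : F = F ⊔ G := Submodule.eq_of_le_of_finrank_le le_sup_left (by rw [hF.1]; omega)
    have e2 : G = F ⊔ G := Submodule.eq_of_le_of_finrank_le le_sup_right (by rw [hG.1]; omega)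
    exact hne (e1.trans e2.symm)
  have step : ∀ C : Finset V, rr (F ⊔ G) C ≤ C.card + 4 →
      ∃ D ⊆ C, rr (F ⊔ G) D = D.card + 4 := by
    intro C
    induction C using Finset.induction_on with
    | empty =>
      intro h
      refine ⟨∅, by simp, ?_⟩
      rw [rr_empty] at h ⊢
      simp at h ⊢
      omega
    | insert e C he ih2 =>
      intro h
      by_cases h2 : rr (F ⊔ G) C ≤ C.card + 4
      · obtain ⟨D, hD, h3⟩ := ih2 h2
        exact ⟨D, hD.trans (Finset.subset_insert _ _), h3⟩
      · refine ⟨insert e C, subset_rfl, ?_⟩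
        have := rr_mono (F ⊔ G) (Finset.subset_insert e C)
        rw [Finset.card_insert_of_notMem he] at h ⊢
        omega
  obtain ⟨D, hDC, hD⟩ := step C (by
    have : rr (F ⊔ G) C ≤ r := by
      rw [← hr]
      apply Submodule.finrank_mono
      exact sup_le (sup_le (hFS F hF) (hFS G hG)) (span_mono (by exact_mod_cast hCS))
    omega)
  have hcard := Finset.card_sdiff_add_card_eq_card hDC
  have ind : ∀ E : Submodule (ZMod 2) V, finrank (ZMod 2) E = 3 →
      rr E C = 3 + (r - 4) → rr E D = D.card + 3 := by
    intro E hE hEC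
    have c1 := rr_union_le E D (C \ D)
    rw [Finset.union_sdiff_of_subset hDC] at c1
    have c2 := rr_union_le E ∅ D
    rw [Finset.empty_union, rr_empty] at c2
    omega
  have hDF := ind F hF.1 (by rw [hCF, hF.1])
  have hDG := ind G hG.1 (by rw [hCG, hG.1])
  refine two_fano (hDC.trans hCS) hF hG (k := D.card) ?_ hDF hDG hD
  have d1 := finrank_span_finset_le_card (R := ZMod 2) D
  unfold Set.finrank at d1
  have d2 := Submodule.finrank_add_le_finrank_add_finrank F (span (ZMod 2) (D : Set V))
  change rr F D ≤ _ at d2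
  have := hF.1
  omega

/-- number of pairs in `X × Y` with sum in `Z` -/
def TT (X Y Z : Finset V) : ℕ := ((X ×ˢ Y).filter (fun p => p.1 + p.2 ∈ Z)).card

theorem TT_swap (X Y Z : Finset V) : TT X Y Z = TT Y X Z := by
  unfold TT
  apply Finset.card_bij (fun p _ => (p.2, p.1))
  · rintro ⟨a, b⟩ h
    simp only [Finset.mem_filter, Finset.mem_product] at h ⊢
    exact ⟨⟨h.1.2, h.1.1⟩, by rw [add_comm]; exact h.2⟩
  · rintro ⟨a, b⟩ _ ⟨c, d⟩ _ h
    simp only [Prod.mk.injEq] at h ⊢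
    exact ⟨h.2, h.1⟩
  · rintro ⟨a, b⟩ h
    simp only [Finset.mem_filter, Finset.mem_product] at h
    exact ⟨(b, a), by
      simp only [Finset.mem_filter, Finset.mem_product]
      exact ⟨⟨h.1.2, h.1.1⟩, by rw [add_comm]; exact h.2⟩, rfl⟩

theorem TT_rot (X Y Z : Finset V) : TT X Y Z = TT X Z Y := by
  have key : ∀ a b : V, a + (a + b) = b := fun a b => by
    rw [← add_assoc, ZModModule.add_self, zero_add]
  unfold TT
  apply Finset.card_bij (fun p _ => (p.1, p.1 + p.2))
  · rintro ⟨a, b⟩ h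
    simp only [Finset.mem_filter, Finset.mem_product] at h ⊢
    exact ⟨⟨h.1.1, h.2⟩, by rw [key]; exact h.1.2⟩
  · rintro ⟨a, b⟩ _ ⟨c, d⟩ _ h
    simp only [Prod.mk.injEq] at h ⊢
    obtain ⟨rfl, h⟩ := h
    exact ⟨rfl, add_left_cancel h⟩
  · rintro ⟨a, b⟩ h
    simp only [Finset.mem_filter, Finset.mem_product] at h
    exact ⟨(a, a + b), by
      simp only [Finset.mem_filter, Finset.mem_product]
      exact ⟨⟨h.1.1, h.2⟩, by rw [key]; exact h.1.2⟩, by simp [key]⟩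

theorem TT_sum (X Y Z : Finset V) : TT X Y Z = ∑ x ∈ X, (Y.filter (fun y => y + x ∈ Z)).card := by
  unfold TT
  rw [Finset.card_filter, Finset.sum_product]
  refine Finset.sum_congr rfl fun x _ => ?_
  rw [Finset.card_filter]
  simp only [add_comm]

theorem TT_union (X Y Y' Z : Finset V) (h : Disjoint Y Y') :
    TT X (Y ∪ Y') Z = TT X Y Z + TT X Y' Z := by
  rw [TT_sum, TT_sum, TT_sum, ← Finset.sum_add_distrib]
  refine Finset.sum_congr rfl fun x _ => ?_
  rw [Finset.filter_union, Finset.card_union_of_disjoint]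
  exact Finset.disjoint_filter_filter h

theorem TT_diag (X : Finset V) : TT X X {0} = X.card := by
  rw [TT_sum, Finset.card_eq_sum_ones]
  refine Finset.sum_congr rfl fun x hx => ?_
  rw [Finset.card_eq_one]
  refine ⟨x, ?_⟩
  ext y
  simp only [Finset.mem_filter, Finset.mem_singleton]
  constructor
  · exact fun h => eq_of_add_zero h.2
  · rintro rfl; exact ⟨hx, ZModModule.add_self _⟩

theorem TT_three {S : Finset V} (h0 : (0 : V) ∉ S) : 3 ∣ TT S S S := by
  let Y := {p : V × V // p.1 ∈ S ∧ p.2 ∈ S ∧ p.1 + p.2 ∈ S}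
  have key : ∀ a b : V, b + (a + b) = a := fun a b => by
    rw [add_comm, add_add_self]
  let f : Function.End Y := fun p => ⟨(p.1.2, p.1.1 + p.1.2), p.2.2.1, p.2.2.2, by
    simp only [key]; exact p.2.1⟩
  have hf : f ^ 3 ^ 1 = 1 := by
    funext p
    obtain ⟨⟨a, b⟩, h⟩ := p
    change f (f (f _)) = _
    simp only [f, Subtype.mk.injEq, key]
    apply Subtype.ext
    change (a, (a + b) + a) = (a, b)
    rw [add_comm a b, add_add_self]
  have hp : Fact (Nat.Prime 3) := ⟨Nat.prime_three⟩
  have h1 := Equiv.Perm.card_fixedPoints_modEq hf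
  have h2 : Fintype.card (Function.fixedPoints f) = 0 := by
    rw [Fintype.card_eq_zero_iff]
    refine ⟨fun ⟨⟨⟨a, b⟩, h⟩, hfix⟩ => ?_⟩
    have h3 : (b, a + b) = (a, b) := congrArg Subtype.val hfix
    simp only [Prod.mk.injEq] at h3
    have : a = 0 := by simpa using h3.2
    exact h0 (this ▸ h.1)
  rw [h2] at h1
  have h3 : Fintype.card Y = TT S S S := by
    unfold TT
    rw [Fintype.card_subtype]
    congr 1
    ext ⟨a, b⟩
    simp [and_assoc]
  rw [← h3]
  exact (Nat.modEq_zero_iff_dvd).1 h1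

/-- pairs in `A` with difference `f` -/
def qq (A : Finset V) (f : V) : ℕ := (A.filter (fun a => a + f ∈ A)).card

theorem qq_ge_two {A : Finset V} {f a : V} (hf : f ≠ 0) (ha : a ∈ A) (haf : a + f ∈ A) :
    2 ≤ qq A f := by
  have : ({a, a + f} : Finset V) ⊆ A.filter (fun a => a + f ∈ A) := by
    intro x hx
    simp only [Finset.mem_insert, Finset.mem_singleton] at hx
    rcases hx with rfl | rfl
    · simp [ha, haf]
    · simp [add_add_self, ha, haf]
  have h2 := Finset.card_le_card this
  rwa [Finset.card_pair (by simpa using hf)] at h2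

theorem qq_sum (A F : Finset V) : ∑ f ∈ F, qq A f = TT A A F := by
  unfold qq
  rw [← TT_sum, TT_swap, TT_rot]

theorem TT_same {A F : Finset V} {W : Submodule (ZMod 2) V} (hF : F = (Wf W).erase 0)
    (hA : ∀ a ∈ A, ∀ b ∈ A, a + b ∈ W) : TT A A F + A.card = A.card * A.card := by
  have h1 : TT A A (Wf W) = A.card * A.card := by
    unfold TT
    rw [Finset.filter_true_of_mem, Finset.card_product]
    rintro ⟨a, b⟩ h
    rw [Finset.mem_product] at h
    exact mem_Wf.2 (hA _ h.1 _ h.2)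
  have h2 : Wf W = F ∪ {0} := by
    rw [hF, Finset.union_comm, ← Finset.insert_eq, Finset.insert_erase (mem_Wf.2 (zero_mem _))]
  rw [TT_rot, h2, TT_union, TT_rot, TT_rot A {0} A, TT_diag] at h1
  · exact h1
  · rw [hF]; simp

theorem case_one {A B C F : Finset V} {W : Submodule (ZMod 2) V} (hF : F = (Wf W).erase 0)
    (hB : ∀ a ∈ B, ∀ b ∈ B, a + b ∈ W)
    (hFc : F.card = 7) (hq1 : ∀ f ∈ F, 2 ≤ qq A f + qq B f + qq C f)
    (hq2 : ∀ f ∈ F, qq A f + qq B f + qq C f ≤ 4)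
    (h1 : A.card = 1) (h2 : B.card = 4) (h3 : C.card = 4) (hT : TT A B C = 4) : False := by
  obtain ⟨a, rfl⟩ := Finset.card_eq_one.1 h1
  have hBC : ∀ b ∈ B, b + a ∈ C := by
    have h4 : B.filter (fun b => b + a ∈ C) = B := by
      apply Finset.eq_of_subset_of_card_le (Finset.filter_subset _ _)
      rw [TT_sum, Finset.sum_singleton] at hT
      omega
    intro b hb
    rw [← h4] at hb
    exact (Finset.mem_filter.1 hb).2
  have hC : B.image (fun b => b + a) = C := by
    apply Finset.eq_of_subset_of_card_le
    · intro c hc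
      obtain ⟨b, hb, rfl⟩ := Finset.mem_image.1 hc
      exact hBC b hb
    · rw [Finset.card_image_of_injective _ (add_left_injective a)]; omega
  have hf0 : ∀ f ∈ F, f ≠ 0 := by
    intro f hf; rw [hF] at hf; exact Finset.ne_of_mem_erase hf
  have hq : ∀ f ∈ F, qq B f = 2 := by
    intro f hf
    have e1 : qq {a} f = 0 := by
      unfold qq
      rw [Finset.card_eq_zero, Finset.filter_eq_empty_iff]
      intro x hx
      simp only [Finset.mem_singleton] at hx ⊢
      subst hx
      simpa using hf0 f hf
    have e2 : qq C f = qq B f := by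
      unfold qq
      symm
      apply Finset.card_bij (fun b _ => b + a)
      · intro b hb
        rw [Finset.mem_filter] at hb ⊢
        refine ⟨hBC b hb.1, ?_⟩
        rw [add_right_comm]; exact hBC _ hb.2
      · intro x _ y _ h
        exact add_left_injective a h
      · intro c hc
        rw [Finset.mem_filter, ← hC, Finset.mem_image, Finset.mem_image] at hc
        obtain ⟨⟨b, hb, rfl⟩, b', hb', h⟩ := hc
        refine ⟨b, ?_, rfl⟩
        rw [Finset.mem_filter]
        refine ⟨hb, ?_⟩
        rw [add_right_comm] at h
        rw [← add_left_injective a h]; exact hb'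
    have e3 := hq1 f hf
    have e4 := hq2 f hf
    have e5 : qq B f ≠ 0 := by omega
    obtain ⟨b, hb⟩ := Finset.card_ne_zero.1 e5
    rw [Finset.mem_filter] at hb
    have := qq_ge_two (hf0 f hf) hb.1 hb.2
    omega
  have hs := qq_sum B F
  rw [Finset.sum_congr rfl hq, Finset.sum_const, hFc] at hs
  have := TT_same hF hB
  rw [← hs, h2] at this
  simp at this

theorem collide {A B F : Finset V} {W : Submodule (ZMod 2) V} (hF : F = (Wf W).erase 0)
    (hA : ∀ a ∈ A, ∀ b ∈ A, a + b ∈ W) (hB : ∀ a ∈ B, ∀ b ∈ B, a + b ∈ W)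
    (hW : (Wf W).card = 8) (h1 : A.card = 3) (h2 : B.card = 3) :
    ∃ f ∈ F, 2 ≤ qq A f ∧ 2 ≤ qq B f := by
  obtain ⟨a0, ha0⟩ := Finset.card_pos.1 (show 0 < A.card by omega)
  obtain ⟨b0, hb0⟩ := Finset.card_pos.1 (show 0 < B.card by omega)
  obtain ⟨⟨a, b⟩, hab, ⟨a', b'⟩, hab', hne, heq⟩ :=
    Finset.exists_ne_map_eq_of_card_lt_of_maps_to (s := A ×ˢ B) (t := Wf W)
    (f := fun p => (p.1 + a0) + (p.2 + b0))
    (by rw [Finset.card_product, hW, h1, h2]; norm_num)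
    (by
      rintro ⟨a, b⟩ h
      have h' : (a, b) ∈ A ×ˢ B := by exact_mod_cast h
      rw [Finset.mem_product] at h'
      exact_mod_cast mem_Wf.2 (add_mem (hA _ h'.1 _ ha0) (hB _ h'.2 _ hb0)))
  rw [Finset.mem_product] at hab hab'
  simp only at heq hab hab'
  have h3 : a + b = a' + b' := by
    have : (a + b) + (a0 + b0) = (a' + b') + (a0 + b0) := by
      calc (a + b) + (a0 + b0) = a + a0 + (b + b0) := by abel
        _ = _ := heq
        _ = _ := by abel
    exact add_right_cancel this
  have hsum : a + a' = b + b' := by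
    apply eq_of_add_zero
    calc a + a' + (b + b') = (a + b) + (a' + b') := by abel
      _ = 0 := by rw [h3, ZModModule.add_self]
  have hne0 : a + a' ≠ 0 := by
    intro h
    have e1 := eq_of_add_zero h
    rw [hsum] at h
    have e2 := eq_of_add_zero h
    exact hne (by rw [e1, e2])
  refine ⟨a + a', ?_, ?_, ?_⟩
  · rw [hF]
    exact Finset.mem_erase.2 ⟨hne0, mem_Wf.2 (hA _ hab.1 _ hab'.1)⟩
  · refine qq_ge_two hne0 hab.1 ?_
    rw [← add_assoc, ZModModule.add_self, zero_add]; exact hab'.1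
  · rw [hsum] at hne0 ⊢
    refine qq_ge_two hne0 hab.2 ?_
    rw [← add_assoc, ZModModule.add_self, zero_add]; exact hab'.2

theorem case_three {A B C F : Finset V} {W : Submodule (ZMod 2) V} (hF : F = (Wf W).erase 0)
    (hA : ∀ a ∈ A, ∀ b ∈ A, a + b ∈ W) (hB : ∀ a ∈ B, ∀ b ∈ B, a + b ∈ W)
    (hC : ∀ a ∈ C, ∀ b ∈ C, a + b ∈ W) (hW : (Wf W).card = 8)
    (hFc : F.card = 7) (hq1 : ∀ f ∈ F, 2 ≤ qq A f + qq B f + qq C f)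
    (hq2 : ∀ f ∈ F, qq A f + qq B f + qq C f ≤ 4)
    (h1 : A.card = 3) (h2 : B.card = 3) (h3 : C.card = 3) : False := by
  obtain ⟨p, hp, hpA, hpB⟩ := collide hF hA hB hW h1 h2
  obtain ⟨q, hq, hqA, hqC⟩ := collide hF hA hC hW h1 h3
  obtain ⟨s, hs, hsB, hsC⟩ := collide hF hB hC hW h2 h3
  have ep := hq2 p hp
  have eq := hq2 q hq
  have es := hq2 s hs
  have hpq : p ≠ q := by rintro rfl; omega
  have hps : p ≠ s := by rintro rfl; omega
  have hqs : q ≠ s := by rintro rfl; omega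
  have sA := qq_sum A F
  have sB := qq_sum B F
  have sC := qq_sum C F
  have tA := TT_same hF hA
  have tB := TT_same hF hB
  have tC := TT_same hF hC
  rw [h1] at tA
  rw [h2] at tB
  rw [h3] at tC
  have hsum : ∑ f ∈ F, (qq A f + qq B f + qq C f) = 18 := by
    rw [Finset.sum_add_distrib, Finset.sum_add_distrib]; omega
  have hsub : ({p, q, s} : Finset V) ⊆ F := by
    intro x hx
    simp only [Finset.mem_insert, Finset.mem_singleton] at hx
    rcases hx with rfl | rfl | rfl <;> assumption
  have hc3 : ({p, q, s} : Finset V).card = 3 := by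
    rw [Finset.card_eq_three]; exact ⟨p, q, s, hpq, hps, hqs, rfl⟩
  rw [← Finset.sum_sdiff hsub] at hsum
  have g1 := Finset.card_nsmul_le_sum (F \ {p, q, s}) (fun f => qq A f + qq B f + qq C f) 2
    (fun f hf => hq1 f (Finset.mem_sdiff.1 hf).1)
  have g2 := Finset.card_nsmul_le_sum ({p, q, s} : Finset V)
    (fun f => qq A f + qq B f + qq C f) 4 (fun f hf => by
      simp only [Finset.mem_insert, Finset.mem_singleton] at hf
      rcases hf with rfl | rfl | rfl <;> omega)
  rw [hc3] at g2
  rw [Finset.card_sdiff_of_subset hsub, hc3, hFc] at g1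
  simp only [smul_eq_mul] at g1 g2
  omega

theorem qq_eq {S : Finset V} {e : V} {l : V →ₗ[ZMod 2] ZMod 2} (hl : l e = 1) :
    qq S e = 2 * (Re S e l).card := by
  unfold qq
  rw [← Finset.card_filter_add_card_filter_not (fun a => l a = 0), two_mul]
  congr 1
  · congr 1
    ext a
    simp only [Finset.mem_filter, mem_Re]
    tauto
  · apply Finset.card_bij (fun a _ => a + e)
    · intro a ha
      simp only [Finset.mem_filter] at ha
      rw [mem_Re, add_add_self, map_add, hl]
      refine ⟨ha.1.2, ha.1.1, ?_⟩
      rcases z2 (l a) with h | h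
      · exact absurd h ha.2
      · rw [h]; decide
    · intro a _ b _ h
      exact add_right_cancel h
    · intro b hb
      rw [mem_Re] at hb
      refine ⟨b + e, ?_, add_add_self _ _⟩
      simp only [Finset.mem_filter, add_add_self, map_add, hl, hb.2.2]
      exact ⟨⟨hb.2.1, hb.1⟩, by decide⟩

theorem TT_congr {X Y Z Z' : Finset V} (h : ∀ x ∈ X, ∀ y ∈ Y, (x + y ∈ Z ↔ x + y ∈ Z')) :
    TT X Y Z = TT X Y Z' := by
  unfold TT
  congr 1
  apply Finset.filter_congr
  rintro ⟨a, b⟩ hab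
  rw [Finset.mem_product] at hab
  exact h _ hab.1 _ hab.2

/-- Colour classes. -/
def col (S : Finset V) (g h : V →ₗ[ZMod 2] ZMod 2) (p q : ZMod 2) : Finset V :=
  S.filter (fun x => g x = p ∧ h x = q)

theorem mem_col {S : Finset V} {g h : V →ₗ[ZMod 2] ZMod 2} {p q : ZMod 2} {x : V} :
    x ∈ col S g h p q ↔ x ∈ S ∧ g x = p ∧ h x = q := by
  simp [col]

theorem col_disj {S : Finset V} {g h : V →ₗ[ZMod 2] ZMod 2} {p q p' q' : ZMod 2}
    (hne : p ≠ p' ∨ q ≠ q') : Disjoint (col S g h p q) (col S g h p' q') := by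
  rw [Finset.disjoint_left]
  intro x h1 h2
  rw [mem_col] at h1 h2
  rcases hne with hne | hne
  · exact hne (h1.2.1.symm.trans h2.2.1)
  · exact hne (h1.2.2.symm.trans h2.2.2)

theorem col_union (S : Finset V) (g h : V →ₗ[ZMod 2] ZMod 2) {p q p' q' : ZMod 2}
    (h1 : p ≠ 0 ∨ q ≠ 0) (h2 : p' ≠ 0 ∨ q' ≠ 0) (h3 : p ≠ p' ∨ q ≠ q') :
    S = col S g h 0 0 ∪ (col S g h p q ∪ (col S g h p' q' ∪ col S g h (p + p') (q + q'))) := by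
  ext x
  simp only [Finset.mem_union, mem_col]
  have key : ∀ p q p' q' s t : ZMod 2, (p ≠ 0 ∨ q ≠ 0) → (p' ≠ 0 ∨ q' ≠ 0) →
      (p ≠ p' ∨ q ≠ q') → (s = 0 ∧ t = 0) ∨ (s = p ∧ t = q) ∨ (s = p' ∧ t = q') ∨
      (s = p + p' ∧ t = q + q') := by decide
  have := key p q p' q' (g x) (h x) h1 h2 h3
  tauto

theorem disj_aux : ∀ p q p' q' : ZMod 2, (p ≠ 0 ∨ q ≠ 0) → (p' ≠ 0 ∨ q' ≠ 0) →
      (p ≠ p' ∨ q ≠ q') → (0 ≠ p ∨ 0 ≠ q) ∧ (0 ≠ p' ∨ 0 ≠ q') ∧ (0 ≠ p + p' ∨ 0 ≠ q + q') ∧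
        (p ≠ p + p' ∨ q ≠ q + q') ∧ (p' ≠ p + p' ∨ q' ≠ q + q') := by
  intro p q p' q'
  rcases z2 p with rfl | rfl <;> rcases z2 q with rfl | rfl <;> rcases z2 p' with rfl | rfl <;>
    rcases z2 q' with rfl | rfl <;> decide

theorem z2_cancel : ∀ p q : ZMod 2, p + (p + q) = q := by decide

theorem TT_split (S : Finset V) (g h : V →ₗ[ZMod 2] ZMod 2) {p q p' q' : ZMod 2}
    (h1 : p ≠ 0 ∨ q ≠ 0) (h2 : p' ≠ 0 ∨ q' ≠ 0) (h3 : p ≠ p' ∨ q ≠ q') (X Z : Finset V) :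
    TT X S Z = TT X (col S g h 0 0) Z + (TT X (col S g h p q) Z + (TT X (col S g h p' q') Z +
      TT X (col S g h (p + p') (q + q')) Z)) := by
  obtain ⟨d1, d2, d3, d4, d5⟩ := disj_aux p q p' q' h1 h2 h3
  conv_lhs => rw [col_union S g h h1 h2 h3]
  rw [TT_union, TT_union, TT_union]
  · exact col_disj d5
  · exact Finset.disjoint_union_right.2 ⟨col_disj h3, col_disj d4⟩
  · exact Finset.disjoint_union_right.2
      ⟨col_disj d1, Finset.disjoint_union_right.2 ⟨col_disj d2, col_disj d3⟩⟩

theorem TT_col (S : Finset V) (g h : V →ₗ[ZMod 2] ZMod 2) (p q p' q' : ZMod 2) :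
    TT (col S g h p q) (col S g h p' q') S =
      TT (col S g h p q) (col S g h p' q') (col S g h (p + p') (q + q')) := by
  apply TT_congr
  intro x hx y hy
  rw [mem_col] at *
  simp [hx.2, hy.2]

theorem class_eq (S : Finset V) (g h : V →ₗ[ZMod 2] ZMod 2) {p q p' q' : ZMod 2}
    (h1 : p ≠ 0 ∨ q ≠ 0) (h2 : p' ≠ 0 ∨ q' ≠ 0) (h3 : p ≠ p' ∨ q ≠ q') :
    TT (col S g h p q) S S = 2 * TT (col S g h p q) (col S g h p q) (col S g h 0 0) +
      2 * TT (col S g h p q) (col S g h p' q') (col S g h (p + p') (q + q')) := by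
  have e1 : p + (p + p') = p' := z2_cancel _ _
  have e2 : q + (q + q') = q' := z2_cancel _ _
  rw [TT_split S g h h1 h2 h3, TT_col, TT_col, TT_col, TT_col, e1, e2,
    ZModModule.add_self, ZModModule.add_self, add_zero, add_zero,
    TT_rot _ (col S g h 0 0), TT_rot _ (col S g h (p + p') (q + q'))]
  ring

theorem qq_TT (S : Finset V) (f : V) : qq S f = TT {f} S S := by
  rw [TT_sum]; simp [qq]

theorem qq_col (S : Finset V) (g h : V →ₗ[ZMod 2] ZMod 2) {f : V} (hg : g f = 0) (hh : h f = 0)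
    (p q : ZMod 2) : TT {f} (col S g h p q) S = qq (col S g h p q) f := by
  rw [qq_TT]
  apply TT_congr
  intro x hx y hy
  rw [Finset.mem_singleton] at hx
  rw [mem_col] at *
  simp [hx, hg, hh, hy.2]

theorem qq_split (S : Finset V) (g h : V →ₗ[ZMod 2] ZMod 2) {f : V} (hg : g f = 0)
    (hh : h f = 0) : qq S f = qq (col S g h 0 0) f + (qq (col S g h 1 0) f +
      (qq (col S g h 0 1) f + qq (col S g h 1 1) f)) := by
  rw [qq_TT, TT_split S g h (p := 1) (q := 0) (p' := 0) (q' := 1) (by decide) (by decide)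
    (by decide)]
  simp only [qq_col S g h hg hh, add_zero, zero_add]

theorem qq_F {F : Submodule (ZMod 2) V} {f : V} (hf : f ∈ (Wf F).erase 0) :
    qq ((Wf F).erase 0) f + 1 = ((Wf F).erase 0).card := by
  rw [← Finset.card_erase_add_one hf]
  congr 1
  unfold qq
  congr 1
  ext a
  simp only [Finset.mem_filter, Finset.mem_erase, mem_Wf, ne_eq] at hf ⊢
  constructor
  · rintro ⟨⟨h1, h2⟩, h3, h4⟩
    refine ⟨?_, h1, h2⟩
    rintro rfl
    exact h3 (ZModModule.add_self _)
  · rintro ⟨h1, h2, h3⟩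
    exact ⟨⟨h2, h3⟩, fun h => h1 (eq_of_add_zero h), add_mem h3 hf.2⟩

theorem arith {a b c t : ℕ} (h : a + b + c = 9) (ha : 8 * a + 2 * a = 2 * (a * a) + 2 * t)
    (hb : 8 * b + 2 * b = 2 * (b * b) + 2 * t) (hc : 8 * c + 2 * c = 2 * (c * c) + 2 * t) :
    (a = 1 ∧ b = 4 ∧ c = 4 ∧ t = 4) ∨ (a = 4 ∧ b = 1 ∧ c = 4 ∧ t = 4) ∨
    (a = 4 ∧ b = 4 ∧ c = 1 ∧ t = 4) ∨ (a = 3 ∧ b = 3 ∧ c = 3) := by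
  have h1 : a ≤ 9 := by omega
  have h2 : b ≤ 9 := by omega
  obtain rfl : c = 9 - a - b := by omega
  interval_cases a <;> interval_cases b <;> omega

theorem exists_l {e : V} (he : e ≠ 0) : ∃ l : V →ₗ[ZMod 2] ZMod 2, l e = 1 := by
  obtain ⟨l, hl, -⟩ := exists_functional (U := (⊥ : Submodule (ZMod 2) V)) (x := e) (by simpa using he)
  exact ⟨l, hl⟩

theorem rank_five {S : Finset V} (h0 : (0 : V) ∉ S) (hAG : ¬ AGv S)
    (ih : ∀ T : Finset V, (0 : V) ∉ T → ¬ AGv T →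
      finrank (ZMod 2) (span (ZMod 2) (T : Set V)) < finrank (ZMod 2) (span (ZMod 2) (S : Set V)) →
      T.card ≤ fm (finrank (ZMod 2) (span (ZMod 2) (T : Set V))))
    (hr : finrank (ZMod 2) (span (ZMod 2) (S : Set V)) = 5) (hS : 15 < S.card) : False := by
  have hne : ∀ e ∈ S, e ≠ 0 := fun e he h => h0 (h ▸ he)
  have uniq : ∀ F G : Submodule (ZMod 2) V, IsFano S F → IsFano S G → F = G :=
    fun F G hF hG => fano_unique h0 hAG ih hr le_rfl (by simpa [fm, Nat.choose] using hS) hF hG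
  have hcon : ∀ e ∈ S, ∀ l : V →ₗ[ZMod 2] ZMod 2, l e = 1 → S.card ≤ 11 + (Re S e l).card + 1 := by
    intro e he l hl
    have := contract h0 hAG ih he hl
    rw [hr] at this
    simpa [fm] using this
  have hge : ∀ e ∈ S, 8 ≤ qq S e := by
    intro e he
    obtain ⟨l, hl⟩ := exists_l (hne e he)
    rw [qq_eq hl]
    have := hcon e he l hl
    omega
  have hno : ∀ e ∈ S, (∀ F, IsFano S F → e ∉ F) → qq S e = 8 ∧ S.card = 16 := by
    intro e he hF
    obtain ⟨l, hl⟩ := exists_l (hne e he)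
    have h1 := hcon e he l hl
    have h2 : (Re S e l).card < 5 := by
      by_contra hlt
      obtain ⟨a, ha, b, hb, hab, hn⟩ := spike h0 hAG he hl (Finset.Subset.refl _) (by rw [hr]; omega)
      obtain ⟨F, hF1, hF2, -⟩ := fano_of_triangle he h0 hl ha hb hab hn
      exact hF F hF1 hF2
    rw [qq_eq hl]
    omega
  by_cases hex : ∃ F, IsFano S F
  swap
  · have h1 : ∀ e ∈ S, qq S e = 8 ∧ S.card = 16 :=
      fun e he => hno e he fun F hF => absurd ⟨F, hF⟩ hex
    obtain ⟨e, he⟩ := Finset.card_pos.1 (show 0 < S.card by omega)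
    have h2 := (h1 e he).2
    have h3 : TT S S S = 128 := by
      rw [TT_sum]
      change ∑ x ∈ S, qq S x = 128
      rw [Finset.sum_congr rfl (fun e he => (h1 e he).1)]
      simp [h2]
    have := TT_three h0
    rw [h3] at this
    omega
  obtain ⟨F, hF⟩ := hex
  have hW : (Wf F).card = 8 := by rw [card_submodule, hF.1]; norm_num
  have hF0c : ((Wf F).erase 0).card = 7 := by
    rw [Finset.card_erase_of_mem (mem_Wf.2 F.zero_mem), hW]
  obtain ⟨F0, hF0⟩ : ∃ F0, F0 = (Wf F).erase 0 := ⟨_, rfl⟩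
  have mF0 : ∀ x, x ∈ F0 ↔ x ≠ 0 ∧ x ∈ F := by
    intro x; rw [hF0, Finset.mem_erase, mem_Wf]
  have hnF : ∀ e ∈ S, e ∉ F → qq S e = 8 ∧ S.card = 16 := by
    intro e he heF
    exact hno e he fun G hG h => heF (uniq G F hG hF ▸ h)
  have hS16 : S.card = 16 := by
    obtain ⟨e, he, heF⟩ : ∃ e ∈ S, e ∉ F0 := by
      by_contra hcon
      push Not at hcon
      have := Finset.card_le_card (show S ⊆ F0 from hcon)
      rw [hF0, hF0c] at this
      omega
    exact (hnF e he fun h => heF ((mF0 e).2 ⟨hne e he, h⟩)).2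
  have hle : ∀ f ∈ F0, qq S f ≤ 10 := by
    intro f hf
    rw [mF0] at hf
    have hfS : f ∈ S := hF.2 f hf.2 hf.1
    obtain ⟨l, hl⟩ := exists_l hf.1
    rw [qq_eq hl]
    by_contra hgt
    obtain ⟨g, hgF, hgf⟩ := exists_notMem_of_finrank (U := span (ZMod 2) {f}) (W := F) (by
      rw [finrank_span_singleton hf.1, hF.1]; norm_num)
    obtain ⟨r0, hr0F, hr0, hlr0⟩ : ∃ r0 ∈ F, r0 ∉ span (ZMod 2) {f} ∧ l r0 = 0 := by
      rcases z2 (l g) with h | h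
      · exact ⟨g, hgF, hgf, h⟩
      · refine ⟨g + f, add_mem hgF hf.2, fun h' => hgf ?_, ?_⟩
        · have := add_mem h' (mem_span_singleton_self f)
          rwa [add_add_self] at this
        · rw [map_add, h, hl]; decide
    have hr00 : r0 ≠ 0 := fun h => hr0 (h ▸ zero_mem _)
    have hr0f : r0 + f ≠ 0 := fun h => hr0 (eq_of_add_zero h ▸ mem_span_singleton_self _)
    have hr0R : r0 ∈ Re S f l := mem_Re.2 ⟨hF.2 _ hr0F hr00, hF.2 _ (add_mem hr0F hf.2) hr0f, hlr0⟩
    have hsub : (Re S f l).erase r0 ⊆ Re S f l := Finset.erase_subset _ _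
    obtain ⟨a, ha, b, hb, hab, hn⟩ := spike h0 hAG hfS hl hsub (by
      rw [hr, Finset.card_erase_of_mem hr0R]; omega)
    obtain ⟨G, hG1, hG2, hG3⟩ := fano_of_triangle hfS h0 hl (hsub ha) (hsub hb) (hsub hab) hn
    have := uniq G F hG1 hF
    subst this
    rcases hG3 r0 hr0F hr00 hlr0 with h | h | h
    · rw [← h] at ha; exact Finset.notMem_erase _ _ ha
    · rw [← h] at hb; exact Finset.notMem_erase _ _ hb
    · rw [← h] at hab; exact Finset.notMem_erase _ _ hab
  -- functionals
  obtain ⟨u, huW, huF⟩ := exists_notMem_of_finrank (U := F) (W := span (ZMod 2) (S : Set V)) (by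
    rw [hF.1, hr]; norm_num)
  have hFu := finrank_sup_singleton huF
  obtain ⟨v, hvW, hvF⟩ := exists_notMem_of_finrank (U := F ⊔ span (ZMod 2) {u})
    (W := span (ZMod 2) (S : Set V)) (by rw [hFu, hF.1, hr]; norm_num)
  have hFuv := finrank_sup_singleton hvF
  obtain ⟨g, hgu, hgF⟩ := exists_functional huF
  obtain ⟨h, hhv, hhF⟩ := exists_functional hvF
  have hFW : F ≤ span (ZMod 2) (S : Set V) := by
    intro x hx
    by_cases hx0 : x = 0
    · rw [hx0]; exact zero_mem _
    · exact subset_span (hF.2 x hx hx0)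
  have hspan : F ⊔ span (ZMod 2) {u} ⊔ span (ZMod 2) {v} = span (ZMod 2) (S : Set V) := by
    apply Submodule.eq_of_le_of_finrank_eq
    · refine sup_le (sup_le hFW ?_) ?_
      · rw [span_le]; simpa using huW
      · rw [span_le]; simpa using hvW
    · rw [hFuv, hFu, hF.1, hr]
  have hhF' : ∀ x ∈ F, h x = 0 := fun x hx => hhF x (Submodule.mem_sup_left hx)
  have hhu : h u = 0 := hhF u (Submodule.mem_sup_right (mem_span_singleton_self _))
  have hmem : ∀ x ∈ span (ZMod 2) (S : Set V), g x = 0 → h x = 0 → x ∈ F := by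
    intro x hx hgx hhx
    have key : ∀ y, y ∈ F ⊔ span (ZMod 2) {u} → g y = 0 → y ∈ F := by
      intro y hy hgy
      rcases mem_sup_singleton.1 hy with hy | hy
      · exact hy
      · have := hgF _ hy
        rw [map_add, hgu, hgy] at this
        exact absurd this (by decide)
    rw [← hspan] at hx
    rcases mem_sup_singleton.1 hx with hx | hx
    · exact key x hx hgx
    · have := hhF _ hx
      rw [map_add, hhv, hhx] at this
      exact absurd this (by decide)
  have hcol0 : col S g h 0 0 = F0 := by
    ext x
    rw [mem_col, mF0]
    constructor
    · rintro ⟨h1, h2, h3⟩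
      exact ⟨hne x h1, hmem x (subset_span h1) h2 h3⟩
    · rintro ⟨h1, h2⟩
      exact ⟨hF.2 x h2 h1, hgF x h2, hhF' x h2⟩
  have hsame : ∀ p q : ZMod 2, ∀ a ∈ col S g h p q, ∀ b ∈ col S g h p q, a + b ∈ F := by
    intro p q a ha b hb
    rw [mem_col] at ha hb
    apply hmem
    · exact add_mem (subset_span ha.1) (subset_span hb.1)
    · rw [map_add, ha.2.1, hb.2.1, ZModModule.add_self]
    · rw [map_add, ha.2.2, hb.2.2, ZModModule.add_self]
  have h8 : ∀ p q : ZMod 2, p ≠ 0 ∨ q ≠ 0 →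
      TT (col S g h p q) S S = 8 * (col S g h p q).card := by
    intro p q hpq
    rw [TT_sum, Finset.sum_congr rfl (fun e he => show _ = 8 from ?_)]
    · simp [mul_comm]
    · rw [mem_col] at he
      refine (hnF e he.1 fun heF => ?_).1
      rw [hgF e heF, hhF' e heF] at he
      rcases hpq with hpq | hpq
      · exact hpq he.2.1.symm
      · exact hpq he.2.2.symm
  have hcl : ∀ p q p' q' : ZMod 2, (p ≠ 0 ∨ q ≠ 0) → (p' ≠ 0 ∨ q' ≠ 0) → (p ≠ p' ∨ q ≠ q') →
      8 * (col S g h p q).card + 2 * (col S g h p q).card =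
        2 * ((col S g h p q).card * (col S g h p q).card) +
        2 * TT (col S g h p q) (col S g h p' q') (col S g h (p + p') (q + q')) := by
    intro p q p' q' h1 h2 h3
    have e1 := class_eq S g h h1 h2 h3
    rw [h8 p q h1, hcol0] at e1
    have e2 := TT_same hF0 (hsame p q)
    omega
  have c1 := hcl 1 0 0 1 (by decide) (by decide) (by decide)
  have c2 := hcl 0 1 1 0 (by decide) (by decide) (by decide)
  have c3 := hcl 1 1 1 0 (by decide) (by decide) (by decide)
  have z11 : (1 : ZMod 2) + 1 = 0 := by decide
  simp only [add_zero, zero_add, z11] at c1 c2 c3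
  have hsum : (col S g h 1 0).card + (col S g h 0 1).card + (col S g h 1 1).card = 9 := by
    have e1 := col_union S g h (p := 1) (q := 0) (p' := 0) (q' := 1) (by decide) (by decide)
      (by decide)
    have e2 := congrArg Finset.card e1
    rw [Finset.card_union_of_disjoint, Finset.card_union_of_disjoint,
      Finset.card_union_of_disjoint, hcol0, hF0, hF0c, hS16] at e2
    · simp only [add_zero, zero_add] at e2; omega
    · exact col_disj (by decide)
    · exact Finset.disjoint_union_right.2 ⟨col_disj (by decide), col_disj (by decide)⟩
    · exact Finset.disjoint_union_right.2 ⟨col_disj (by decide),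
        Finset.disjoint_union_right.2 ⟨col_disj (by decide), col_disj (by decide)⟩⟩
  have hqf : ∀ f ∈ F0, 2 ≤ qq (col S g h 1 0) f + qq (col S g h 0 1) f + qq (col S g h 1 1) f ∧
      qq (col S g h 1 0) f + qq (col S g h 0 1) f + qq (col S g h 1 1) f ≤ 4 := by
    intro f hf
    have h1 := hle f hf
    have hf' := (mF0 f).1 hf
    have h2 := hge f (hF.2 f hf'.2 hf'.1)
    have h3 := qq_split S g h (hgF f hf'.2) (hhF' f hf'.2)
    have h4 := qq_F (hF0 ▸ hf)
    rw [hF0c] at h4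
    rw [hcol0, hF0] at h3
    omega
  rw [TT_swap] at c2
  have e3 : TT (col S g h 1 1) (col S g h 1 0) (col S g h 0 1) =
      TT (col S g h 1 0) (col S g h 0 1) (col S g h 1 1) := by rw [TT_swap, TT_rot]
  rw [e3] at c3
  have hF7 : F0.card = 7 := by rw [hF0, hF0c]
  rcases arith hsum c1 c2 c3 with ⟨n1, n2, n3, n4⟩ | ⟨n1, n2, n3, n4⟩ | ⟨n1, n2, n3, n4⟩ |
    ⟨n1, n2, n3⟩
  · exact case_one hF0 (hsame 0 1) hF7 (fun f hf => (hqf f hf).1) (fun f hf => (hqf f hf).2)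
      n1 n2 n3 n4
  · refine case_one hF0 (hsame 1 0) hF7 (fun f hf => ?_) (fun f hf => ?_) n2 n1 n3
      (by rw [TT_swap]; exact n4)
    · have := (hqf f hf).1; omega
    · have := (hqf f hf).2; omega
  · refine case_one hF0 (hsame 1 0) hF7 (fun f hf => ?_) (fun f hf => ?_) n3 n1 n2
      (by rw [e3]; exact n4)
    · have := (hqf f hf).1; omega
    · have := (hqf f hf).2; omega
  · exact case_three hF0 (hsame 1 0) (hsame 0 1) (hsame 1 1) hW hF7 (fun f hf => (hqf f hf).1)
      (fun f hf => (hqf f hf).2) n1 n2 n3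

theorem main_vec : ∀ (r : ℕ) (S : Finset V), (0 : V) ∉ S → ¬ AGv S →
    finrank (ZMod 2) (span (ZMod 2) (S : Set V)) = r → S.card ≤ fm r := by
  intro r
  induction r using Nat.strong_induction_on with
  | _ r IH =>
  intro S h0 hAG hr
  have ih : ∀ T : Finset V, (0 : V) ∉ T → ¬ AGv T →
      finrank (ZMod 2) (span (ZMod 2) (T : Set V)) < finrank (ZMod 2) (span (ZMod 2) (S : Set V)) →
      T.card ≤ fm (finrank (ZMod 2) (span (ZMod 2) (T : Set V))) := by
    intro T h1 h2 h3
    exact IH _ (hr ▸ h3) T h1 h2 rfl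
  by_cases hr3 : r ≤ 3
  · have h1 := card_le_pow h0 (W := span (ZMod 2) (S : Set V)) (fun s hs => subset_span hs)
    rw [hr] at h1
    interval_cases r <;> simp [fm] at * <;> omega
  by_cases hr4 : r = 4
  · subst hr4
    exact rank_four h0 hAG hr
  by_contra hlt
  push Not at hlt
  by_cases hr5 : r = 5
  · subst hr5
    exact rank_five h0 hAG ih hr (by simpa [fm, Nat.choose] using hlt)
  have hne : ∀ e ∈ S, e ≠ 0 := fun e he h => h0 (h ▸ he)
  have hfano : ∀ e ∈ S, ∃ F, IsFano S F ∧ e ∈ F := by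
    intro e he
    obtain ⟨l, hl⟩ := exists_l (hne e he)
    have h1 := contract h0 hAG ih he hl
    obtain ⟨k, rfl⟩ : ∃ k, r = k + 1 := ⟨r - 1, by omega⟩
    rw [hr, Nat.add_sub_cancel] at h1
    have h2 := fm_eq (r := k) (by omega)
    have h3 := fm_eq (r := k + 1) (by omega)
    have h4 : k + 1 ≤ (Re S e l).card := by nlinarith
    obtain ⟨a, ha, b, hb, hab, hn⟩ := spike h0 hAG he hl (Finset.Subset.refl _) (by rw [hr]; exact h4)
    obtain ⟨F, hF1, hF2, -⟩ := fano_of_triangle he h0 hl ha hb hab hn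
    exact ⟨F, hF1, hF2⟩
  obtain ⟨e, he⟩ := Finset.card_pos.1 (show 0 < S.card by omega)
  obtain ⟨F, hF, -⟩ := hfano e he
  have h1 := card_le_pow h0 (W := F) (fun s hs => by
    obtain ⟨G, hG, hs'⟩ := hfano s hs
    have := fano_unique h0 hAG ih hr (by omega) hlt hG hF
    exact this ▸ hs')
  rw [hF.1] at h1
  have h2 := fm_eq (r := r) (by omega)
  have : 6 ≤ r := by omega
  nlinarith

theorem ag_transfer {α : Type*} (M : Matroid α) (φ : α → V) (hrep : M.IsRepBy (ZMod 2) φ)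
    (S : Finset V) (hS : (S : Set V) = φ '' M.E) (h : AGv S) : M.HasAGMinor := by
  obtain ⟨C, hC, w, x, y, z, h1, h2⟩ := h
  obtain ⟨U, hU⟩ : ∃ U, U = span (ZMod 2) C := ⟨_, rfl⟩
  rw [← hU] at h1 h2
  have hrep' : ∀ I ⊆ M.E, (M.Indep I ↔ LinearIndepOn (ZMod 2) φ I) := hrep
  obtain ⟨C0, hC0⟩ : ∃ C0 : Set α, C0 = {e ∈ M.E | φ e ∈ C} := ⟨_, rfl⟩
  have hC0E : C0 ⊆ M.E := by rw [hC0]; exact fun e he => he.1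
  obtain ⟨J, hJ⟩ := M.exists_isBasis C0 hC0E
  have hJE : J ⊆ M.E := hJ.subset.trans hC0E
  have hJi : LinearIndepOn (ZMod 2) φ J := (hrep' J hJE).1 hJ.indep
  have hJU : span (ZMod 2) (φ '' J) = U := by
    rw [hU]
    apply le_antisymm
    · rw [span_le]
      rintro _ ⟨e, he, rfl⟩
      have := hJ.subset he
      rw [hC0] at this
      exact subset_span this.2
    · rw [span_le]
      intro c hc
      have hcS := hC hc
      rw [hS] at hcS
      obtain ⟨e, he, rfl⟩ := hcS
      by_contra hn
      have heC : e ∈ C0 := by rw [hC0]; exact ⟨he, hc⟩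
      have h3 : M.Indep (insert e J) :=
        (hrep' _ (Set.insert_subset he hJE)).2 (hJi.insert hn)
      have h4 := hJ.mem_of_insert_indep heC h3
      exact hn (subset_span ⟨e, h4, rfl⟩)
  obtain ⟨i, hi⟩ : ∃ i : (Fin 4 → ZMod 2) →ₗ[ZMod 2] (V ⧸ U), ∀ t, i t =
      U.mkQ (t 0 • w + t 1 • x + t 2 • y + t 3 • z) := by
    refine ⟨U.mkQ ∘ₗ (Fintype.linearCombination (ZMod 2) ![w, x, y, z]), fun t => ?_⟩
    simp [Fintype.linearCombination_apply, Fin.sum_univ_four]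
  have hker : LinearMap.ker i = ⊥ := by
    rw [LinearMap.ker_eq_bot']
    intro t ht
    rw [hi, mkQ_apply, Submodule.Quotient.mk_eq_zero] at ht
    obtain ⟨a, b, c, d⟩ := h1 _ _ _ _ ht
    funext k
    fin_cases k <;> assumption
  obtain ⟨L, hL⟩ := LinearMap.exists_leftInverse_of_injective i hker
  have hL' : ∀ t, L (i t) = t := fun t => by
    have := congrArg (fun f => f t) hL
    simpa using this
  have hex : ∀ t : Fin 4 → ZMod 2, t ∈ agVecs → ∃ e ∈ M.E, U.mkQ (φ e) = i t := by
    intro t ht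
    obtain ⟨s, hs, hsu⟩ := h2 (t 1) (t 2) (t 3)
    have hs' : s ∈ (S : Set V) := hs
    rw [hS] at hs'
    obtain ⟨e, he, rfl⟩ := hs'
    refine ⟨e, he, ?_⟩
    have ht0 : t 0 = 1 := ht
    rw [hi, ht0, one_smul, mkQ_apply, mkQ_apply, Submodule.Quotient.eq]
    rwa [ZModModule.sub_eq_add]
  have hne : Nonempty α := by
    obtain ⟨e, -⟩ := hex 1 rfl
    exact ⟨e⟩
  choose! ee he1 he2 using hex
  obtain ⟨X, hX⟩ : ∃ X, X = ee '' agVecs := ⟨_, rfl⟩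
  have hXE : X ⊆ M.E := by
    rw [hX]; rintro _ ⟨t, ht, rfl⟩; exact he1 t ht
  have hXC : Disjoint C0 X := by
    rw [Set.disjoint_left]
    intro e he heX
    rw [hX] at heX
    obtain ⟨t, ht, rfl⟩ := heX
    rw [hC0] at he
    have h3 : φ (ee t) ∈ U := by rw [hU]; exact subset_span he.2
    have h4 := he2 t ht
    rw [mkQ_apply, (Submodule.Quotient.mk_eq_zero U).2 h3] at h4
    have h5 := hL' t
    rw [← h4, map_zero] at h5
    have ht0 : t 0 = 1 := ht
    rw [← h5] at ht0
    exact absurd ht0 (by decide)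
  have hψ : ∀ t ∈ agVecs, L (U.mkQ (φ (ee t))) = t := fun t ht => by rw [he2 t ht, hL']
  have hNE : ((M ／ C0) ＼ (M.E \ X)).E = X := by
    rw [Matroid.delete_ground, Matroid.contract_ground]
    ext e
    simp only [Set.mem_diff]
    constructor
    · rintro ⟨⟨a, b⟩, c⟩
      by_contra hn
      exact c ⟨a, hn⟩
    · intro he
      exact ⟨⟨hXE he, fun h => Set.disjoint_left.1 hXC h he⟩, fun h => h.2 he⟩
  refine ⟨(M ／ C0) ＼ (M.E \ X), ⟨C0, M.E \ X, rfl⟩, fun e => L (U.mkQ (φ e)), ?_, ?_⟩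
  · intro I hI
    rw [hNE] at hI
    have hdj : Disjoint C0 I := hXC.mono_right hI
    rw [Matroid.delete_indep_iff, and_iff_left (Set.disjoint_left.2 fun e he h => h.2 (hI he)),
      hJ.contract_indep_iff_of_disjoint hdj, hrep' _ (Set.union_subset (hI.trans hXE) hJE),
      Set.union_comm, ← hJi.quotient_iff_union (hdj.mono_left hJ.subset), hJU]
    change LinearIndepOn _ _ _ ↔ LinearIndepOn (ZMod 2) (fun e => L (U.mkQ (φ e))) I
    have heq : Set.EqOn (U.mkQ ∘ φ) (i ∘ (fun e => L (U.mkQ (φ e)))) I := by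
      intro e he
      have := hI he
      rw [hX] at this
      obtain ⟨t, ht, rfl⟩ := this
      simp only [Function.comp]
      rw [hψ t ht, he2 t ht]
    rw [linearIndepOn_congr heq]
    constructor
    · intro h; exact LinearIndepOn.of_comp i h
    · intro h; exact h.map_injOn i (LinearMap.ker_eq_bot.1 hker).injOn
  · rw [hNE, hX]
    refine ⟨?_, ?_, ?_⟩
    · rintro _ ⟨t, ht, rfl⟩
      simp only [hψ t ht]; exact ht
    · rintro _ ⟨t, ht, rfl⟩ _ ⟨t', ht', rfl⟩ h
      simp only [hψ t ht, hψ t' ht'] at h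
      rw [h]
    · intro t ht
      exact ⟨ee t, ⟨t, ht, rfl⟩, hψ t ht⟩

theorem final {α : Type*} (M : Matroid α) (φ : α → V) (hrep : M.IsRepBy (ZMod 2) φ)
    (hsimple : M.IsSimpleM) (hAG : ¬ M.HasAGMinor) : M.E.ncard ≤ fm M.rkM := by
  have hrep' : ∀ I ⊆ M.E, (M.Indep I ↔ LinearIndepOn (ZMod 2) φ I) := hrep
  have hpair : ∀ e ∈ M.E, ∀ f ∈ M.E, LinearIndepOn (ZMod 2) φ {e, f} := by
    intro e he f hf
    exact (hrep' _ (Set.insert_subset he (Set.singleton_subset_iff.2 hf))).1 (hsimple e he f hf)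
  have hinj : Set.InjOn φ M.E := by
    intro e he f hf h
    exact (hpair e he f hf).injOn (by simp) (by simp) h
  obtain ⟨S, hS⟩ : ∃ S : Finset V, (S : Set V) = φ '' M.E :=
    ⟨(Set.toFinite (φ '' M.E)).toFinset, by simp⟩
  have h0 : (0 : V) ∉ S := by
    intro h
    have h' : (0 : V) ∈ (S : Set V) := h
    rw [hS] at h'
    obtain ⟨e, he, h⟩ := h'
    exact (hpair e he e he).ne_zero (i := e) (by simp) h
  have hcard : M.E.ncard = S.card := by
    rw [← Set.ncard_coe_finset, hS, Set.ncard_image_of_injOn hinj]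
  have hrk : M.rkM = finrank (ZMod 2) (span (ZMod 2) (S : Set V)) := by
    unfold Matroid.rkM Matroid.rks
    apply IsGreatest.csSup_eq
    constructor
    · obtain ⟨t, ht1, ht2, ht3, ht4⟩ :=
        exists_finset_span_eq_linearIndepOn (ZMod 2) (S : Set V)
      rw [hS] at ht1
      obtain ⟨I, hI, hIt⟩ := Set.subset_image_iff.1 ht1
      refine ⟨I, hI, (hrep' I hI).2 ?_, ?_⟩
      · rw [← hIt] at ht4
        exact (linearIndepOn_iff_image (hinj.mono hI)).2 ht4
      · rw [← ht2, ← Set.ncard_coe_finset, ← hIt, Set.ncard_image_of_injOn (hinj.mono hI)]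
    · rintro _ ⟨I, hI, hIi, rfl⟩
      have h1 := (linearIndepOn_iff_image (hinj.mono hI)).1 ((hrep' I hI).1 hIi)
      rw [← Set.ncard_image_of_injOn (hinj.mono hI)]
      have h3 : φ '' I ⊆ S := by rw [hS]; exact Set.image_mono hI
      haveI : Fintype (φ '' I) := Fintype.ofFinite _
      have h2 := finrank_span_set_eq_card (R := ZMod 2) (s := φ '' I) h1
      rw [← Set.ncard_eq_toFinset_card'] at h2
      rw [← h2]
      exact Submodule.finrank_mono (span_mono h3)
  rw [hcard, hrk]
  exact main_vec _ S h0 (fun h => hAG (ag_transfer M φ hrep S hS h)) rfl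

end AGP

theorem max_size_no_AG32 {α : Type*} (M : Matroid α) (r : ℕ) (hr : 5 ≤ r)
    (hbin : M.IsBinaryM) (hsimple : M.IsSimpleM) (hrank : M.rkM = r)
    (hAG : ¬ M.HasAGMinor) :
    M.E.ncard ≤ (r + 1).choose 2 := by
  classical
  obtain ⟨n, φ, hφ⟩ := hbin
  have h := AGP.final M φ hφ hsimple hAG
  rw [hrank] at h
  rwa [AGP.fm, if_neg (by omega), if_neg (by omega)] at h
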